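/- arXiv:2209.12286 — 2 statements merged into one kernel-verified Lean document; each statement's English description precedes it below -/
import Mathlib

section
/- For all integers 1 ≤ j < g and every odd s with 1 ≤ s ≤ 2j−1, one has σ ∘ D_s^{(g)} = D_s^{(j)} ∘ σ as maps B_g → B_j; that is, the polynomial vector field D_s defined for genus g is tangent to the coordinate subspace ℂ^{3j} ⊂ ℂ^{3g} and its restriction there coincides with the vector field D_s defined for genus j. -/
open MvPolynomial

noncomputable section

/-- B_g = ℂ[b_{i,j} : i ∈ {1,2,3}, j odd, 1 ≤ j ≤ 2g−1], as a polynomial ring in 3g variables;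
the variable (i, m) : Fin 3 × Fin g stands for b_{i+1, 2m+1}. -/
abbrev Bg (g : ℕ) : Type := MvPolynomial (Fin 3 × Fin g) ℂ

/-- `bb g i m` is the variable b_{i, 2m−1} (zero if i ∉ {1,2,3} or m ∉ {1,…,g}). -/
noncomputable def bb (g : ℕ) (i m : ℕ) : Bg g :=
  if h : 1 ≤ i ∧ i ≤ 3 ∧ 1 ≤ m ∧ m ≤ g then
    MvPolynomial.X (⟨i - 1, by omega⟩, ⟨m - 1, by omega⟩) else 0

/-- `bv g i j` is the variable b_{i,j} for odd j (zero for j > 2g−1). -/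
noncomputable def bv (g : ℕ) (i j : ℕ) : Bg g :=
  if Odd j then bb g i ((j + 1) / 2) else 0

/-- `Qg g a c` is p_{2a−1, 2c−1} for 1 ≤ a ≤ c, by the elimination recursion. -/
noncomputable def Qg (g : ℕ) : ℕ → ℕ → Bg g
  | 0, _ => 0
  | 1, c => 2 * bb g 1 c
  | 2, c => 6 * bb g 1 1 * bb g 1 c - bb g 3 c + 6 * bb g 1 (c + 1)
  | 3, c => bb g 3 1 * bb g 1 c - bb g 2 1 * bb g 2 c + bb g 1 1 * bb g 3 c
      - 2 * (4 * bb g 1 1 ^ 2 + bb g 1 2) * bb g 1 c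
      + 10 * bb g 1 1 * bb g 1 (c + 1) - 2 * bb g 3 (c + 1) + 10 * bb g 1 (c + 2)
  | (a + 4), c => 2 * (if c + 1 ≤ g then Qg g (a + 3) (c + 1) else 0)
      - (if c + 2 ≤ g then Qg g (a + 2) (c + 2) else 0)
      - 8 * bb g 1 1 * bb g 1 (a + 2) * bb g 1 c - 2 * bb g 1 c * bb g 1 (a + 3)
      - 2 * bb g 1 (a + 2) * bb g 1 (c + 1) + bb g 1 (a + 2) * bb g 3 c
      - bb g 2 (a + 2) * bb g 2 c + bb g 3 (a + 2) * bb g 1 c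

/-- `pp g k l` is p_{k,l} for odd k, l (zero if k > 2g−1 or l > 2g−1). -/
noncomputable def pp (g : ℕ) (k l : ℕ) : Bg g :=
  if Odd k ∧ Odd l ∧ k ≤ 2 * g - 1 ∧ l ≤ 2 * g - 1 then
    if k ≤ l then Qg g ((k + 1) / 2) ((l + 1) / 2) else Qg g ((l + 1) / 2) ((k + 1) / 2)
  else 0

/-- 𝐛ᵢ(ξ) = Σ_{m=1}^{g} b_{i,2m−1} ξᵐ ∈ B_g[ξ]. -/
noncomputable def Bcoef (g i : ℕ) : Polynomial (Bg g) :=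
  ∑ m ∈ Finset.Icc 1 g, Polynomial.C (bb g i m) * Polynomial.X ^ m

/-- The polynomial ξ𝐛₂(ξ)² + 2ξ𝐛₃(ξ)(1 − 𝐛₁(ξ)) + 4(1 + 2b_{1,1}ξ)(1 − 𝐛₁(ξ))². -/
noncomputable def Fg (g : ℕ) : Polynomial (Bg g) :=
  Polynomial.X * (Bcoef g 2) ^ 2 + 2 * Polynomial.X * Bcoef g 3 * (1 - Bcoef g 1)
    + 4 * (1 + 2 * Polynomial.C (bb g 1 1) * Polynomial.X) * (1 - Bcoef g 1) ^ 2

/-- `lam g m` is λ_{2m+2}, defined by 4λ_{2m+2} = coefficient of ξ^{m+1} in `Fg g`. -/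
noncomputable def lam (g m : ℕ) : Bg g := ((1 : ℂ) / 4) • ((Fg g).coeff (m + 1))

/-- The polynomial vector field D₁ on B_g:
D₁(b_{1,j}) = b_{2,j}, D₁(b_{2,j}) = b_{3,j},
D₁(b_{3,j}) = 4(2b_{1,1}b_{2,j} + b_{2,1}b_{1,j} + b_{2,j+2}) (with b_{2,2g+1} = 0). -/
noncomputable def D1g (g : ℕ) : Derivation ℂ (Bg g) (Bg g) :=
  MvPolynomial.mkDerivation ℂ (fun v : Fin 3 × Fin g =>
    if (v.1 : ℕ) = 0 then bb g 2 ((v.2 : ℕ) + 1)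
    else if (v.1 : ℕ) = 1 then bb g 3 ((v.2 : ℕ) + 1)
    else 4 * (2 * bb g 1 1 * bb g 2 ((v.2 : ℕ) + 1) + bb g 2 1 * bb g 1 ((v.2 : ℕ) + 1)
      + bb g 2 ((v.2 : ℕ) + 2)))

/-- The polynomial vector field D_s on B_g (for odd s ≥ 3):
D_s(b_{i,j}) = (1/2)·D₁ⁱ(p_{s,j}); for s = 1 it is D₁.  (For s = 2g+1 the
conventions p_{s,j} = 0 make it the zero vector field.) -/
noncomputable def Dsg (g s : ℕ) : Derivation ℂ (Bg g) (Bg g) :=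
  if s = 1 then D1g g else
  MvPolynomial.mkDerivation ℂ (fun v : Fin 3 × Fin g =>
    ((1 : ℂ) / 2) • (((D1g g).toLinearMap ^ ((v.1 : ℕ) + 1)) (pp g s (2 * (v.2 : ℕ) + 1))))

/-- The multiplication operator by c ∈ B_g. -/
noncomputable def mulBg (g : ℕ) (c : Bg g) : Module.End ℂ (Bg g) := LinearMap.mulLeft ℂ c

/-- D_s as a ℂ-linear endomorphism of B_g. -/
noncomputable def DLg (g s : ℕ) : Module.End ℂ (Bg g) := (Dsg g s).toLinearMap

/-- ℒ = D₁² − 2b_{1,1}. -/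
noncomputable def Lg (g : ℕ) : Module.End ℂ (Bg g) := DLg g 1 ^ 2 - mulBg g (2 * bb g 1 1)

/-- The Buchstaber–Shorina polynomial differential operator
ℬ_{2k+1} = D_{2k−1}D₁² − (b_{1,1}D_{2k−1} + D_{2k−1}b_{1,1})
  − (1/2)(b_{1,2k−1}D₁ + D₁b_{1,2k−1}) − D_{2k+1}. -/
noncomputable def Bopg (g k : ℕ) : Module.End ℂ (Bg g) :=
  DLg g (2 * k - 1) * DLg g 1 ^ 2
    - (mulBg g (bb g 1 1) * DLg g (2 * k - 1) + DLg g (2 * k - 1) * mulBg g (bb g 1 1))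
    - ((1 : ℂ) / 2) • (mulBg g (bv g 1 (2 * k - 1)) * DLg g 1 + DLg g 1 * mulBg g (bv g 1 (2 * k - 1)))
    - DLg g (2 * k + 1)

/-- σ : B_g → B_j, the ℂ-algebra homomorphism with σ(b_{i,l}) = b_{i,l} for
odd l ≤ 2j−1 and σ(b_{i,l}) = 0 for odd l with 2j−1 < l ≤ 2g−1. -/
noncomputable def sg (g j : ℕ) : Bg g →ₐ[ℂ] Bg j :=
  MvPolynomial.aeval (fun v : Fin 3 × Fin g =>
    if h : (v.2 : ℕ) < j then (MvPolynomial.X (v.1, ⟨(v.2 : ℕ), h⟩) : Bg j) else 0)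

lemma sg_bb {g j : ℕ} (h : j ≤ g) (i m : ℕ) : sg g j (bb g i m) = bb j i m := by
  unfold bb
  by_cases hm : 1 ≤ i ∧ i ≤ 3 ∧ 1 ≤ m ∧ m ≤ g
  · rw [dif_pos hm, sg, aeval_X]
    by_cases hmj : m ≤ j
    · rw [dif_pos (show m - 1 < j by omega), dif_pos ⟨hm.1, hm.2.1, hm.2.2.1, hmj⟩]
    · rw [dif_neg (show ¬ m - 1 < j by omega), dif_neg (by omega)]
  · rw [dif_neg hm, dif_neg (by omega), map_zero]

lemma bb_eq_zero {g m : ℕ} (i : ℕ) (h : g < m) : bb g i m = 0 :=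
  dif_neg (by omega)

lemma X_eq_bb (g : ℕ) (v : Fin 3 × Fin g) :
    (X v : Bg g) = bb g ((v.1 : ℕ) + 1) ((v.2 : ℕ) + 1) := by
  obtain ⟨⟨a, ha⟩, ⟨b, hb⟩⟩ := v
  rw [bb, dif_pos (by simp only; omega)]
  rfl

lemma Qg_eq_zero {g : ℕ} (a c : ℕ) (h : g < c) : Qg g a c = 0 := by
  have h0 (i) : bb g i c = 0 := bb_eq_zero i h
  have h1 (i) : bb g i (c + 1) = 0 := bb_eq_zero i (by omega)
  have h2 (i) : bb g i (c + 2) = 0 := bb_eq_zero i (by omega)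
  match a with
  | 0 => rw [Qg]
  | 1 => simp [Qg, h0]
  | 2 => simp [Qg, h0, h1]
  | 3 => simp [Qg, h0, h1, h2]
  | a + 4 =>
    rw [Qg, if_neg (by omega), if_neg (by omega)]
    simp [h0, h1]

lemma sg_Qg {g j : ℕ} (h : j ≤ g) (a c : ℕ) : sg g j (Qg g a c) = Qg j a c := by
  have guarded (a c : ℕ) (ih : sg g j (Qg g a c) = Qg j a c) :
      sg g j (if c ≤ g then Qg g a c else 0) = if c ≤ j then Qg j a c else 0 := by
    by_cases hcj : c ≤ j
    · rw [if_pos hcj, if_pos (hcj.trans h), ih]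
    · rw [if_neg hcj]
      split_ifs
      · rw [ih, Qg_eq_zero _ _ (by omega)]
      · exact map_zero _
  induction a using Nat.strong_induction_on generalizing c with
  | _ a ih =>
    match a with
    | 0 => simp [Qg]
    | 1 => simp [Qg, sg_bb h, map_ofNat]
    | 2 => simp [Qg, sg_bb h, map_ofNat]
    | 3 => simp [Qg, sg_bb h, map_ofNat]
    | a + 4 =>
      rw [Qg, Qg]
      simp only [map_add, map_sub, map_mul, map_ofNat, sg_bb h,
        guarded _ _ (ih (a + 3) (by omega) (c + 1)), guarded _ _ (ih (a + 2) (by omega) (c + 2))]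

lemma sg_pp {g j : ℕ} (h : j ≤ g) {s : ℕ} (hs : s ≤ 2 * j - 1) (l : ℕ) :
    sg g j (pp g s l) = pp j s l := by
  unfold pp
  by_cases hl : Odd s ∧ Odd l ∧ s ≤ 2 * g - 1 ∧ l ≤ 2 * g - 1
  · rw [if_pos hl]
    obtain ⟨hs1, hl1, -, -⟩ := hl
    by_cases hlj : Odd s ∧ Odd l ∧ s ≤ 2 * j - 1 ∧ l ≤ 2 * j - 1
    · rw [if_pos hlj]
      split_ifs <;> exact sg_Qg h _ _
    · have hlt : 2 * j - 1 < l := by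
        by_contra hc
        exact hlj ⟨hs1, hl1, hs, by omega⟩
      obtain ⟨m, rfl⟩ := hl1
      rw [if_neg hlj, if_pos (show s ≤ 2 * m + 1 by omega), sg_Qg h, Qg_eq_zero _ _ (by omega)]
  · rw [if_neg hl, if_neg (fun hc => hl ⟨hc.1, hc.2.1, by omega, by omega⟩), map_zero]

/-- Two derivations intertwined by an algebra map on the variables are intertwined everywhere. -/
lemma derivation_intertwine {σ R A : Type*} [CommRing R] [CommRing A] [Algebra R A]
    (φ : MvPolynomial σ R →ₐ[R] A) (D : Derivation R (MvPolynomial σ R) (MvPolynomial σ R))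
    (E : Derivation R A A) (h : ∀ v, φ (D (X v)) = E (φ (X v))) (f : MvPolynomial σ R) :
    φ (D f) = E (φ f) := by
  induction f using MvPolynomial.induction_on with
  | C a => simp [← MvPolynomial.algebraMap_eq]
  | add p q hp hq => simp only [map_add, hp, hq]
  | mul_X p v hp =>
    simp only [Derivation.leibniz, map_add, map_mul, smul_eq_mul, hp, h]

lemma D1g_bb_one (g m : ℕ) : D1g g (bb g 1 m) = bb g 2 m := by
  by_cases h : 1 ≤ m ∧ m ≤ g
  · obtain ⟨m, rfl⟩ := Nat.exists_eq_add_of_le' h.1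
    have hX : X (0, ⟨m, by omega⟩) = bb g 1 (m + 1) := X_eq_bb g _
    rw [← hX, D1g, mkDerivation_X]
    simp
  · simp [bb, h]

lemma D1g_bb_two (g m : ℕ) : D1g g (bb g 2 m) = bb g 3 m := by
  by_cases h : 1 ≤ m ∧ m ≤ g
  · obtain ⟨m, rfl⟩ := Nat.exists_eq_add_of_le' h.1
    have hX : X (1, ⟨m, by omega⟩) = bb g 2 (m + 1) := X_eq_bb g _
    rw [← hX, D1g, mkDerivation_X]
    simp
  · simp [bb, h]

lemma D1g_bb_three {g m : ℕ} (hm : 1 ≤ m) :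
    D1g g (bb g 3 m) = 4 * (2 * bb g 1 1 * bb g 2 m + bb g 2 1 * bb g 1 m + bb g 2 (m + 1)) := by
  by_cases h : m ≤ g
  · obtain ⟨m, rfl⟩ := Nat.exists_eq_add_of_le' hm
    have hX : X (2, ⟨m, by omega⟩) = bb g 3 (m + 1) := X_eq_bb g _
    rw [← hX, D1g, mkDerivation_X]
    simp
  · simp [bb_eq_zero _ (show g < m by omega), bb_eq_zero _ (show g < m + 1 by omega)]

lemma sg_D1g {g j : ℕ} (h : j ≤ g) (f : Bg g) : sg g j (D1g g f) = D1g j (sg g j f) := by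
  refine derivation_intertwine _ _ _ (fun v => ?_) f
  rw [X_eq_bb, sg_bb h]
  obtain ⟨i, m⟩ := v
  fin_cases i
  · simp [D1g_bb_one, sg_bb h]
  · simp [D1g_bb_two, sg_bb h]
  · simp [D1g_bb_three, sg_bb h, map_ofNat]

lemma sg_D1g_pow {g j : ℕ} (h : j ≤ g) (n : ℕ) (f : Bg g) :
    sg g j (((D1g g).toLinearMap ^ n) f) = ((D1g j).toLinearMap ^ n) (sg g j f) := by
  induction n with
  | zero => rfl
  | succ n ih =>
    rw [pow_succ', pow_succ', Module.End.mul_apply, Module.End.mul_apply, ← ih]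
    exact sg_D1g h _

/-- for 1 ≤ j < g and odd s ≤ 2j−1, σ ∘ D_s^{(g)} = D_s^{(j)} ∘ σ. -/
theorem stmt9 (g j : ℕ) (hj : 1 ≤ j) (hjg : j < g) :
    ∀ s, Odd s → 1 ≤ s → s ≤ 2 * j - 1 →
      ∀ f : Bg g, sg g j (Dsg g s f) = Dsg j s (sg g j f) := by
  intro s _ _ hs
  have h : j ≤ g := hjg.le
  by_cases hs1 : s = 1
  · subst hs1
    simpa [Dsg] using sg_D1g h
  intro f
  refine derivation_intertwine _ _ _ (fun v => ?_) f
  rw [Dsg, Dsg, if_neg hs1, if_neg hs1, mkDerivation_X, map_smul, sg_D1g_pow h, sg_pp h hs,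
    sg, aeval_X]
  by_cases hv : (v.2 : ℕ) < j
  · rw [dif_pos hv, mkDerivation_X]
  · rw [dif_neg hv, map_zero, pp, if_neg (by omega), map_zero, smul_zero]

end
end

section
/- Assume the operators L, B₃, …, B_{2g+1} commute. Then there exist constants μ₄, μ₆, …, μ_{4g+2} ∈ ℂ such that, identically on Ω, ξ·𝐛₂(ξ)² + 2ξ·𝐛₃(ξ)(1 − 𝐛₁(ξ)) + 4(1 + v₂ξ)(1 − 𝐛₁(ξ))² = 4 + 4Σ_{i=1}^{2g} μ_{2i+2} ξ^{i+1} as polynomials in ξ, where 𝐛₁(ξ) = (1/2)Σ_{i=1}^{g} v_{2i} ξⁱ, 𝐛₂(ξ) = (1/2)Σ_{i=1}^{g} (∂₁v_{2i}) ξⁱ, 𝐛₃(ξ) = (1/2)Σ_{i=1}^{g} (∂₁²v_{2i}) ξⁱ. Moreover, for any such constants μ, defining a₄, a₆, a₈, … ∈ ℂ recursively by 2a_{2k+2} = μ_{2k+2} − Σ_{i=1}^{k−2} a_{2i+2}·a_{2k−2i} for k ≥ 1 (with μ_{2k+2} := 0 for k > 2g), the function u = v₂ is a solution of the parametric Korteweg–de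 Vries hierarchy with parameters a: for every integer k ≥ 1, ∂_{2k+1}u = r_{2k+3}[u] + Σ_{j=0}^{k−2} a_{2k−2j}·r_{2j+3}[u] holds on Ω, where ∂_{2k+1}u := 0 whenever 2k+1 > 2g−1 (so for k ≥ g these equations are the higher stationary KdV equations). -/
/-!
STATEMENT 17. If the Buchstaber–Shorina operators L, B₃, …, B_{2g+1} commute, the
generating identity holds for some constants μ and v₂ solves the parametric KdV
hierarchy with the parameters a determined by μ.
-/

open MvPolynomial

noncomputable section

/-- The algebra ℋ = ℂ[u₀, u₁, u₂, …]. -/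
abbrev HH : Type := MvPolynomial ℕ ℂ

/-- The derivation ∂ with ∂(uᵢ) = uᵢ₊₁. -/
noncomputable def Hder : Derivation ℂ HH HH :=
  MvPolynomial.mkDerivation ℂ (fun i => MvPolynomial.X (i + 1))

/-- ∂ as a ℂ-linear endomorphism of ℋ. -/
noncomputable def Dop : Module.End ℂ HH := Hder.toLinearMap

/-- The multiplication operator by c ∈ ℋ. -/
noncomputable def mulH (c : HH) : Module.End ℂ HH := LinearMap.mulLeft ℂ c

/-- L = ∂² − u₀. -/
noncomputable def LopH : Module.End ℂ HH := Dop ^ 2 - mulH (MvPolynomial.X 0)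

/-- The grading: wt(uᵢ) = i + 2. -/
def wtH : ℕ → ℕ := fun i => i + 2

/-- A_{2k+1} = ∂^{2k+1} + Σ_{j=1}^{k} (α_{2j} ∘ ∂^{2k−2j+1} + ∂^{2k−2j+1} ∘ α_{2j}). -/
noncomputable def AopH (k : ℕ) (α : Fin k → HH) : Module.End ℂ HH :=
  Dop ^ (2 * k + 1) +
    ∑ j : Fin k, (mulH (α j) * Dop ^ (2 * k - 2 * ((j : ℕ) + 1) + 1)
      + Dop ^ (2 * k - 2 * ((j : ℕ) + 1) + 1) * mulH (α j))

/-- The partial derivative ∂_{2m−1} with respect to the m-th coordinate t_{2m−1} of ℂᵍ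
(zero for m > g, in accordance with the convention ∂_{2g+1} = 0). -/
noncomputable def pd (g : ℕ) (m : ℕ) (f : (Fin g → ℂ) → ℂ) : (Fin g → ℂ) → ℂ :=
  fun t => if h : 1 ≤ m ∧ m - 1 < g then fderiv ℂ f t (Pi.single (⟨m - 1, h.2⟩ : Fin g) 1) else 0

/-- L f = ∂₁²f − v₂·f (here `v m` denotes v_{2m}). -/
noncomputable def Lfun (g : ℕ) (v : ℕ → (Fin g → ℂ) → ℂ) (f : (Fin g → ℂ) → ℂ) :
    (Fin g → ℂ) → ℂ :=
  pd g 1 (pd g 1 f) - v 1 * f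

/-- B_{2k+1} f = ∂_{2k−1}∂₁²f − (1/2)(v₂·∂_{2k−1}f + ∂_{2k−1}(v₂·f))
− (1/4)(v_{2k}·∂₁f + ∂₁(v_{2k}·f)) − ∂_{2k+1}f (with ∂_{2g+1} = 0). -/
noncomputable def Bfun (g : ℕ) (v : ℕ → (Fin g → ℂ) → ℂ) (k : ℕ) (f : (Fin g → ℂ) → ℂ) :
    (Fin g → ℂ) → ℂ :=
  pd g k (pd g 1 (pd g 1 f))
    - ((1 : ℂ) / 2) • (v 1 * pd g k f + pd g k (v 1 * f))
    - ((1 : ℂ) / 4) • (v k * pd g 1 f + pd g 1 (v k * f)) - pd g (k + 1) f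

/-- The operators L, B₃, …, B_{2g+1} commute (on holomorphic functions on Ω). -/
def OpsCommute (g : ℕ) (Ω : Set (Fin g → ℂ)) (v : ℕ → (Fin g → ℂ) → ℂ) : Prop :=
  ∀ f : (Fin g → ℂ) → ℂ, AnalyticOnNhd ℂ f Ω →
    ∀ k l, 1 ≤ k → k ≤ g → 1 ≤ l → l ≤ g →
      Set.EqOn (Lfun g v (Bfun g v k f)) (Bfun g v k (Lfun g v f)) Ω ∧
      Set.EqOn (Bfun g v k (Bfun g v l f)) (Bfun g v l (Bfun g v k f)) Ω

/-- 𝐛ᵢ(ξ) evaluated at t : the polynomial (1/2)Σ_{m=1}^{g} (∂₁^{i−1}v_{2m})(t) ξᵐ. -/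
noncomputable def cpoly (g : ℕ) (v : ℕ → (Fin g → ℂ) → ℂ) (i : ℕ) (t : Fin g → ℂ) :
    Polynomial ℂ :=
  ∑ m ∈ Finset.Icc 1 g, Polynomial.C (((1 : ℂ) / 2) * ((pd g 1)^[i - 1] (v m)) t)
    * Polynomial.X ^ m

/-- The generating identity: for all t ∈ Ω,
ξ𝐛₂(ξ)² + 2ξ𝐛₃(ξ)(1 − 𝐛₁(ξ)) + 4(1 + v₂ξ)(1 − 𝐛₁(ξ))² = 4 + 4Σ_{i=1}^{2g} μ_{2i+2}ξ^{i+1}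
as polynomials in ξ (here `μ i` denotes μ_{2i+2}). -/
def GenIdent (g : ℕ) (Ω : Set (Fin g → ℂ)) (v : ℕ → (Fin g → ℂ) → ℂ) (μ : ℕ → ℂ) : Prop :=
  ∀ t ∈ Ω,
    Polynomial.X * (cpoly g v 2 t) ^ 2
      + 2 * Polynomial.X * cpoly g v 3 t * (1 - cpoly g v 1 t)
      + 4 * (1 + Polynomial.C (v 1 t) * Polynomial.X) * (1 - cpoly g v 1 t) ^ 2
    = 4 + 4 * ∑ i ∈ Finset.Icc 1 (2 * g), Polynomial.C (μ i) * Polynomial.X ^ (i + 1)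

section
variable {R : Type*} [CommRing R] [Algebra ℂ R]

/-- The Schrödinger operator `∂₁² - v₁` attached to a family `D` of derivations. -/
def schr (D : ℕ → Derivation ℂ R R) (v : ℕ → R) (f : R) : R := D 1 (D 1 f) - v 1 * f

/-- The operator `∂ₖ∂₁² - (v₁∂ₖ + ∂ₖv₁) / 2 - (vₖ∂₁ + ∂₁vₖ) / 4 - ∂ₖ₊₁` attached to a family `D` of
derivations. -/
noncomputable def bsOp (D : ℕ → Derivation ℂ R R) (v : ℕ → R) (k : ℕ) (f : R) : R :=
  D k (D 1 (D 1 f)) - ((1 : ℂ) / 2) • (v 1 * D k f + D k (v 1 * f))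
    - ((1 : ℂ) / 4) • (v k * D 1 f + D 1 (v k * f)) - D (k + 1) f

theorem four_mul_bsOp (D : ℕ → Derivation ℂ R R) (v : ℕ → R) (k : ℕ) (f : R) :
    4 * bsOp D v k f = 4 * D k (D 1 (D 1 f)) - 2 * (v 1 * D k f + D k (v 1 * f))
      - (v k * D 1 f + D 1 (v k * f)) - 4 * D (k + 1) f := by
  have h2 : (algebraMap ℂ R (1 / 2)) * 2 = 1 := by
    rw [← map_ofNat (algebraMap ℂ R) 2, ← map_mul]; norm_num
  have h4 : (algebraMap ℂ R (1 / 4)) * 4 = 1 := by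
    rw [← map_ofNat (algebraMap ℂ R) 4, ← map_mul]; norm_num
  simp only [bsOp, Algebra.smul_def]
  linear_combination (-2 * (v 1 * D k f + D k (v 1 * f))) * h2
    - (v k * D 1 f + D 1 (v k * f)) * h4

theorem ofNat_mul_cancel {n : ℕ} [n.AtLeastTwo] {a b : R}
    (h : (OfNat.ofNat n : R) * a = OfNat.ofNat n * b) : a = b := by
  have hn : ((OfNat.ofNat n : ℂ)) ≠ 0 := OfNat.ofNat_ne_zero n
  have h' : (OfNat.ofNat n : ℂ) • a = (OfNat.ofNat n : ℂ) • b := by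
    simpa [Algebra.smul_def, map_ofNat] using h
  simpa [smul_smul, inv_mul_cancel₀ hn] using congrArg (fun z => (OfNat.ofNat n : ℂ)⁻¹ • z) h'

theorem Derivation.map_ofNat (d : Derivation ℂ R R) (n : ℕ) [n.AtLeastTwo] :
    d (ofNat(n) : R) = 0 := by
  rw [← Nat.cast_ofNat]
  exact d.map_natCast n

theorem schr_comm_bsOp (D : ℕ → Derivation ℂ R R) (hD : ∀ i j f, D i (D j f) = D j (D i f))
    (v : ℕ → R) (k : ℕ) (f : R) :
    4 * (schr D v (bsOp D v k f) - bsOp D v k (schr D v f)) =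
      4 * (D k (v 1) - D 1 (v k)) * D 1 (D 1 f)
      + 4 * (D 1 (D k (v 1) - D 1 (v k))) * D 1 f
      + (2 * D 1 (D 1 (D k (v 1))) - 4 * v 1 * D k (v 1) - 2 * v k * D 1 (v 1)
          - D 1 (D 1 (D 1 (v k))) - 4 * D (k + 1) (v 1)) * f := by
  have e : 4 * schr D v (bsOp D v k f) = schr D v (4 * bsOp D v k f) := by
    simp only [schr, Derivation.leibniz, Derivation.map_ofNat, smul_eq_mul, mul_zero, add_zero]
    ring
  rw [mul_sub, e, four_mul_bsOp, four_mul_bsOp]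
  simp only [schr, map_add, map_sub, Derivation.leibniz, Derivation.map_ofNat, smul_eq_mul,
    mul_zero, add_zero]
  simp only [hD _ 1 _]
  ring

theorem commute_schr (D : ℕ → Derivation ℂ R R) (hD : ∀ i j f, D i (D j f) = D j (D i f))
    (v : ℕ → R) (k : ℕ) (x : R) (hx : D 1 x = 1)
    (h : ∀ f, schr D v (bsOp D v k f) = bsOp D v k (schr D v f)) :
    D k (v 1) = D 1 (v k) ∧
      4 * D (k + 1) (v 1) =
        D 1 (D 1 (D 1 (v k))) - 4 * v 1 * D 1 (v k) - 2 * v k * D 1 (v 1) := by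
  have key := fun f => (schr_comm_bsOp D hD v k f).symm.trans (by rw [h f, sub_self, mul_zero])
  have h0 := key 1
  have h1 := key x
  have h2 := key (x * x)
  simp only [Derivation.leibniz, hx, smul_eq_mul, map_add, Derivation.map_one_eq_zero, mul_one,
    mul_zero, zero_add,
    map_zero] at h0 h1 h2
  have hp : D k (v 1) = D 1 (v k) := by
    apply ofNat_mul_cancel (n := 8)
    linear_combination h2 - 2 * x * h1 + x * x * h0
  refine ⟨hp, ?_⟩
  rw [hp] at h0
  linear_combination -h0

theorem bsOp_comm (D : ℕ → Derivation ℂ R R) (hD : ∀ i j f, D i (D j f) = D j (D i f))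
    (v : ℕ → R) (k l : ℕ) (f : R)
    (hk : ∀ f, schr D v (bsOp D v k f) = bsOp D v k (schr D v f))
    (hl : ∀ f, schr D v (bsOp D v l f) = bsOp D v l (schr D v f))
    (hvk : D k (v 1) = D 1 (v k)) (hvl : D l (v 1) = D 1 (v l)) :
    16 * (bsOp D v k (bsOp D v l f) - bsOp D v l (bsOp D v k f)) =
      - 8 * (D k (v l) - D l (v k)) * D 1 (schr D v f)
      + 4 * (D 1 (D k (v l) - D l (v k))) * schr D v f
      + (8 * (D (k + 1) (v l) - D (l + 1) (v k))
          + 4 * (v k * D 1 (v l) - v l * D 1 (v k))) * D 1 f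
      - (4 * (D 1 (D (k + 1) (v l)) - D 1 (D (l + 1) (v k)))
          + 2 * (v k * D 1 (D 1 (v l)) - v l * D 1 (D 1 (v k)))) * f := by
  have red : ∀ j, D j (v 1) = D 1 (v j) → ∀ f, 4 * bsOp D v j f =
      4 * D j (schr D v f) - 2 * v j * D 1 f + D 1 (v j) * f - 4 * D (j + 1) f := by
    intro j hj f
    rw [four_mul_bsOp]
    simp only [schr, map_sub, Derivation.leibniz, smul_eq_mul, hj]
    ring
  have e : ∀ i j, D i (v 1) = D 1 (v i) → D j (v 1) = D 1 (v j) →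
      (∀ f, schr D v (bsOp D v j f) = bsOp D v j (schr D v f)) →
      16 * bsOp D v i (bsOp D v j f) =
        4 * D i (4 * bsOp D v j (schr D v f)) - 2 * v i * D 1 (4 * bsOp D v j f)
          + D 1 (v i) * (4 * bsOp D v j f) - 4 * D (i + 1) (4 * bsOp D v j f) := by
    intro i j hi hj hc
    have := red i hi (bsOp D v j f)
    rw [hc] at this
    simp only [Derivation.leibniz, Derivation.map_ofNat, smul_eq_mul]
    linear_combination 4 * this
  rw [mul_sub, e k l hvk hvl hl, e l k hvl hvk hk]
  simp only [red k hvk, red l hvl]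
  generalize schr D v (schr D v f) = h₂
  generalize schr D v f = h
  simp only [map_add, map_sub, Derivation.leibniz, Derivation.map_ofNat, smul_eq_mul,
    mul_zero, add_zero]
  simp only [hD]
  ring

theorem commute_bsOp (D : ℕ → Derivation ℂ R R) (hD : ∀ i j f, D i (D j f) = D j (D i f))
    (v : ℕ → R) (k l : ℕ) (x : R) (hx : D 1 x = 1)
    (hk : ∀ f, schr D v (bsOp D v k f) = bsOp D v k (schr D v f))
    (hl : ∀ f, schr D v (bsOp D v l f) = bsOp D v l (schr D v f))
    (h : ∀ f, bsOp D v k (bsOp D v l f) = bsOp D v l (bsOp D v k f)) :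
    D k (v l) = D l (v k) ∧
      2 * (D (k + 1) (v l) - D (l + 1) (v k)) = v l * D 1 (v k) - v k * D 1 (v l) := by
  have hvk := (commute_schr D hD v k x hx hk).1
  have hvl := (commute_schr D hD v l x hx hl).1
  have key := fun f => (bsOp_comm D hD v k l f hk hl hvk hvl).symm.trans
    (by rw [h f, sub_self, mul_zero])
  have hP : D 1 (D k (v l) - D l (v k)) = 0 := by
    rw [map_sub, hD 1 k, hD 1 l, ← hvk, ← hvl, hD k l, sub_self]
  have h0 := key 1
  have h1 := key x
  have h3 := key (x * x * x)
  simp only [hP, schr, Derivation.leibniz, hx, smul_eq_mul, map_add, map_sub,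
    Derivation.map_one_eq_zero, mul_one, mul_zero, zero_add, zero_sub, map_zero,
      map_neg] at h0 h1 h3
  have hp : D k (v l) = D l (v k) := by
    apply ofNat_mul_cancel (n := 48)
    linear_combination -h3 + 3 * x * x * h1 - 2 * x * x * x * h0
  refine ⟨hp, ?_⟩
  rw [hp] at h0 h1
  apply ofNat_mul_cancel (n := 4)
  linear_combination h1 - x * h0
end

section
open scoped PowerSeries
variable {R : Type*} [CommRing R] [Algebra ℂ R]

/-- The coefficientwise extension of a derivation to power series. -/
noncomputable def coeffDeriv (d : Derivation ℂ R R) : Derivation ℂ R⟦X⟧ R⟦X⟧ :=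
  Derivation.mk'
    { toFun := fun f => PowerSeries.mk fun n => d (PowerSeries.coeff n f)
      map_add' := fun f g => by ext n; simp
      map_smul' := fun c f => by ext n; simp }
    (fun f g => by
      ext n
      simp only [LinearMap.coe_mk, AddHom.coe_mk, PowerSeries.coeff_mk, PowerSeries.coeff_mul,
        map_sum, Derivation.leibniz, smul_eq_mul, map_add, Finset.sum_add_distrib]
      congr 1
      rw [← Finset.Nat.sum_antidiagonal_swap]
      rfl)

@[simp]
theorem coeff_coeffDeriv (d : Derivation ℂ R R) (f : R⟦X⟧) (n : ℕ) :
    PowerSeries.coeff n (coeffDeriv d f) = d (PowerSeries.coeff n f) := by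
  simp [coeffDeriv]

@[simp]
theorem constantCoeff_coeffDeriv (d : Derivation ℂ R R) (f : R⟦X⟧) :
    PowerSeries.constantCoeff (coeffDeriv d f) = d (PowerSeries.constantCoeff f) := by
  rw [← PowerSeries.coeff_zero_eq_constantCoeff_apply, coeff_coeffDeriv,
    PowerSeries.coeff_zero_eq_constantCoeff_apply]

@[simp]
theorem coeffDeriv_X (d : Derivation ℂ R R) : coeffDeriv d PowerSeries.X = 0 := by
  ext n
  rw [coeff_coeffDeriv, PowerSeries.coeff_X]
  split_ifs <;> simp

@[simp]
theorem coeffDeriv_C (d : Derivation ℂ R R) (a : R) :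
    coeffDeriv d (PowerSeries.C a) = PowerSeries.C (d a) := by
  ext n
  rw [coeff_coeffDeriv, PowerSeries.coeff_C, PowerSeries.coeff_C]
  split_ifs <;> simp

theorem coeffDeriv_mk (d : Derivation ℂ R R) (f : ℕ → R) :
    coeffDeriv d (PowerSeries.mk f) = PowerSeries.mk fun n => d (f n) := by
  ext n
  simp

/-- The first integral `X (dT)² - 2 X (d²T) T + 4 (1 + u X) T²` of the third-order equation
satisfied by the generating series of the Gelfand–Dickey polynomials. -/
noncomputable def genQuad (d : Derivation ℂ R R) (u : R) (T : R⟦X⟧) : R⟦X⟧ :=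
  PowerSeries.X * coeffDeriv d T ^ 2 - 2 * PowerSeries.X * coeffDeriv d (coeffDeriv d T) * T
    + 4 * (1 + PowerSeries.C u * PowerSeries.X) * T ^ 2

theorem coeffDeriv_genQuad_self (d : Derivation ℂ R R) (u : R) (T : R⟦X⟧) :
    coeffDeriv d (genQuad d u T) =
      2 * T * (4 * coeffDeriv d T - PowerSeries.X * (coeffDeriv d (coeffDeriv d (coeffDeriv d T))
        - 4 * PowerSeries.C u * coeffDeriv d T - 2 * PowerSeries.C (d u) * T)) := by
  simp only [genQuad, pow_two, map_add, map_sub, Derivation.leibniz, smul_eq_mul,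
    Derivation.map_ofNat, Derivation.map_one_eq_zero, coeffDeriv_X, coeffDeriv_C]
  ring

theorem coeffDeriv_genQuad (D : ℕ → Derivation ℂ R R)
    (hD : ∀ i j f, D i (D j f) = D j (D i f)) (V : ℕ → R) (hV : V 0 = -2)
    (hlin : ∀ k, 4 * D 1 (V (k + 1)) =
      D 1 (D 1 (D 1 (V k))) - 4 * V 1 * D 1 (V k) - 2 * D 1 (V 1) * V k)
    (l : ℕ) (hl : D l (V 1) = D 1 (V l)) (hl' : D (l + 1) (V 1) = D 1 (V (l + 1)))
    (hrel : ∀ k, 2 * (D l (V (k + 1)) - D (l + 1) (V k)) = V l * D 1 (V k) - V k * D 1 (V l)) :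
    coeffDeriv (D l) (genQuad (D 1) (V 1) (PowerSeries.mk V)) =
      PowerSeries.X * coeffDeriv (D (l + 1)) (genQuad (D 1) (V 1) (PowerSeries.mk V)) := by
  have hc : ∀ i (f : R⟦X⟧), coeffDeriv (D i) (coeffDeriv (D 1) f) =
      coeffDeriv (D 1) (coeffDeriv (D i) f) := by
    intro i f
    ext n
    simp [hD i 1]
  have hV0 : ∀ i, D i (V 0) = 0 := by
    intro i
    rw [hV, map_neg, Derivation.map_ofNat, neg_zero]
  have h1 : 4 * coeffDeriv (D 1) (PowerSeries.mk V) =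
      PowerSeries.X * (coeffDeriv (D 1) (coeffDeriv (D 1) (coeffDeriv (D 1) (PowerSeries.mk V)))
        - 4 * PowerSeries.C (V 1) * coeffDeriv (D 1) (PowerSeries.mk V)
        - 2 * PowerSeries.C (D 1 (V 1)) * PowerSeries.mk V) := by
    ext n
    rw [← map_ofNat (PowerSeries.C (R := R)) 4, ← map_ofNat (PowerSeries.C (R := R)) 2, mul_assoc,
      mul_assoc]
    cases n with
    | zero => simp [hV0]
    | succ k =>
      simp only [PowerSeries.coeff_C_mul, PowerSeries.coeff_succ_X_mul, coeffDeriv_mk,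
        PowerSeries.coeff_mk, map_sub, hlin]
      ring
  have h2 : 2 * (coeffDeriv (D l) (PowerSeries.mk V) -
        PowerSeries.X * coeffDeriv (D (l + 1)) (PowerSeries.mk V)) =
      PowerSeries.X * (PowerSeries.C (V l) * coeffDeriv (D 1) (PowerSeries.mk V) -
        PowerSeries.C (D 1 (V l)) * PowerSeries.mk V) := by
    ext n
    rw [← map_ofNat (PowerSeries.C (R := R)) 2]
    cases n with
    | zero => simp [hV0]
    | succ k =>
      simp only [PowerSeries.coeff_C_mul, PowerSeries.coeff_succ_X_mul, coeffDeriv_mk,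
        PowerSeries.coeff_mk, map_sub, hrel]
      ring
  have h3 := congrArg (coeffDeriv (D 1)) h2
  have h4 := congrArg (coeffDeriv (D 1)) h3
  have h5 := congrArg (PowerSeries.C (R := R)) (hlin l)
  simp only [map_add, map_sub, Derivation.leibniz, smul_eq_mul, map_mul, map_ofNat,
    Derivation.map_ofNat, mul_zero, add_zero, coeffDeriv_X, coeffDeriv_C] at h3 h4 h5
  simp only [genQuad, pow_two, map_add, map_sub, Derivation.leibniz, smul_eq_mul,
    Derivation.map_ofNat, Derivation.map_one_eq_zero, coeffDeriv_X, coeffDeriv_C, mul_zero,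
    add_zero, zero_add, hc, hl, hl']
  generalize PowerSeries.mk V = T at *
  generalize coeffDeriv (D 1) (coeffDeriv (D 1) (coeffDeriv (D 1) T)) = T3 at *
  generalize coeffDeriv (D 1) (coeffDeriv (D 1) T) = T2 at *
  linear_combination PowerSeries.X * coeffDeriv (D 1) T * h3 - PowerSeries.X * T * h4 -
    PowerSeries.X * T2 * h2
    + 4 * (1 + PowerSeries.C (V 1) * PowerSeries.X) * T * h2 - PowerSeries.X ^ 2 * T * T * h5 +
      PowerSeries.X * T * PowerSeries.C (V l) * h1

theorem coeff_succ_genQuad (d : Derivation ℂ R R) (u : R) (f : ℕ → R) (hf : f 0 = -2) (n : ℕ) :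
    PowerSeries.coeff (n + 1) (genQuad d u (PowerSeries.mk f)) =
      ∑ i ∈ Finset.range (n + 1),
        (d (f i) * d (f (n - i)) - 2 * d (d (f i)) * f (n - i) + 4 * u * f i * f (n - i))
      + 4 * ∑ i ∈ Finset.range n, f (i + 1) * f (n - i) - 16 * f (n + 1) := by
  have : genQuad d u (PowerSeries.mk f) =
      PowerSeries.X * (coeffDeriv d (PowerSeries.mk f) * coeffDeriv d (PowerSeries.mk f)
      - PowerSeries.C 2 * (coeffDeriv d (coeffDeriv d (PowerSeries.mk f)) * PowerSeries.mk f) +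
        PowerSeries.C (4 * u) * (PowerSeries.mk f * PowerSeries.mk f))
      + PowerSeries.C 4 * (PowerSeries.mk f * PowerSeries.mk f) := by
    simp only [genQuad, map_mul, map_ofNat]
    ring
  rw [this]
  simp only [map_add, map_sub, PowerSeries.coeff_succ_X_mul, PowerSeries.coeff_C_mul, coeffDeriv_mk]
  simp only [PowerSeries.coeff_mul, PowerSeries.coeff_mk,
    Finset.Nat.sum_antidiagonal_eq_sum_range_succ_mk, Finset.mul_sum, Finset.sum_add_distrib,
    Finset.sum_sub_distrib]
  have hs : ∑ i ∈ Finset.range (n + 1 + 1), 4 * (f i * f (n + 1 - i)) =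
      ∑ i ∈ Finset.range n, 4 * (f (i + 1) * f (n - i)) - 16 * f (n + 1) := by
    rw [Finset.sum_range_succ, Finset.sum_range_succ']
    simp only [Nat.add_sub_add_right, Nat.sub_self, Nat.sub_zero, hf]
    ring
  simp only [Nat.succ_eq_add_one, mul_assoc, hs]
  ring

/-- The Gelfand–Dickey sequence: the coefficients of the power series `T` with constant term `-2`
and `genQuad d u T = 16`. -/
noncomputable def gdSeq (d : Derivation ℂ R R) (u : R) : ℕ → R
  | 0 => -2
  | n + 1 => ((1 : ℂ) / 16) • (∑ i : Fin (n + 1),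
        (d (gdSeq d u i) * d (gdSeq d u (n - i)) - 2 * d (d (gdSeq d u i)) * gdSeq d u (n - i)
          + 4 * u * gdSeq d u i * gdSeq d u (n - i))
      + 4 * ∑ i : Fin n, gdSeq d u (i + 1) * gdSeq d u (n - i))

theorem gdSeq_zero (d : Derivation ℂ R R) (u : R) : gdSeq d u 0 = -2 := by
  rw [gdSeq]

theorem gdSeq_succ (d : Derivation ℂ R R) (u : R) (n : ℕ) : 16 * gdSeq d u (n + 1) =
    ∑ i ∈ Finset.range (n + 1), (d (gdSeq d u i) * d (gdSeq d u (n - i))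
        - 2 * d (d (gdSeq d u i)) * gdSeq d u (n - i)
        + 4 * u * gdSeq d u i * gdSeq d u (n - i))
      + 4 * ∑ i ∈ Finset.range n, gdSeq d u (i + 1) * gdSeq d u (n - i) := by
  have h16 : (algebraMap ℂ R (1 / 16)) * 16 = 1 := by
    rw [← map_ofNat (algebraMap ℂ R) 16, ← map_mul]; norm_num
  rw [gdSeq, Algebra.smul_def, ← mul_assoc, mul_comm 16, h16, one_mul,
    ← Fin.sum_univ_eq_sum_range (fun i => d (gdSeq d u i) * d (gdSeq d u (n - i))
        - 2 * d (d (gdSeq d u i)) * gdSeq d u (n - i)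
        + 4 * u * gdSeq d u i * gdSeq d u (n - i)),
    ← Fin.sum_univ_eq_sum_range (fun i => gdSeq d u (i + 1) * gdSeq d u (n - i))]

theorem genQuad_gdSeq (d : Derivation ℂ R R) (u : R) :
    genQuad d u (PowerSeries.mk (gdSeq d u)) = 16 := by
  ext n
  rw [← map_ofNat (PowerSeries.C (R := R)) 16]
  cases n with
  | zero =>
    simp [genQuad, gdSeq_zero, coeffDeriv_mk, map_ofNat]
    norm_num
  | succ n =>
    rw [coeff_succ_genQuad d u _ (gdSeq_zero d u), gdSeq_succ, PowerSeries.coeff_C]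
    simp

theorem eq_gdSeq (d : Derivation ℂ R R) (u : R) (f : ℕ → R) (hf : f 0 = -2)
    (h : genQuad d u (PowerSeries.mk f) = 16) (n : ℕ) : f n = gdSeq d u n := by
  induction n using Nat.strong_induction_on with
  | _ n ih =>
    cases n with
    | zero => rw [hf, gdSeq_zero]
    | succ n =>
      apply ofNat_mul_cancel (n := 16)
      have hn := congrArg (PowerSeries.coeff (n + 1)) h
      rw [← map_ofNat (PowerSeries.C (R := R)) 16, PowerSeries.coeff_C, if_neg n.succ_ne_zero,
        coeff_succ_genQuad d u f hf, sub_eq_zero] at hn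
      rw [← hn, gdSeq_succ]
      congr 1
      · refine Finset.sum_congr rfl fun i hi => ?_
        rw [Finset.mem_range] at hi
        rw [ih i (by omega), ih (n - i) (by omega)]
      · congr 1
        refine Finset.sum_congr rfl fun i hi => ?_
        rw [Finset.mem_range] at hi
        rw [ih (i + 1) (by omega), ih (n - i) (by omega)]

theorem map_gdSeq {S : Type*} [CommRing S] [Algebra ℂ S] (d : Derivation ℂ R R)
    (e : Derivation ℂ S S) (φ : R →+* S) (hφ : ∀ p, φ (d p) = e (φ p)) (u : R) (n : ℕ) :
    φ (gdSeq d u n) = gdSeq e (φ u) n := by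
  have hc : ∀ f : R⟦X⟧, PowerSeries.map φ (coeffDeriv d f) =
      coeffDeriv e (PowerSeries.map φ f) := by
    intro f
    ext n
    simp [hφ]
  have hm : (PowerSeries.mk fun n => φ (gdSeq d u n)) =
      PowerSeries.map φ (PowerSeries.mk (gdSeq d u)) := by
    ext n
    simp
  refine eq_gdSeq e (φ u) (fun n => φ (gdSeq d u n)) (by simp [gdSeq_zero, map_ofNat]) ?_ n
  have := congrArg (PowerSeries.map φ) (genQuad_gdSeq d u)
  simp only [genQuad, map_add, map_sub, map_mul, map_pow, hc, map_ofNat, map_one, PowerSeries.map_X,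
    PowerSeries.map_C] at this
  rw [hm]
  exact this

theorem deriv_gdSeq_succ [IsDomain R] (d : Derivation ℂ R R) (u : R) (k : ℕ) :
    4 * d (gdSeq d u (k + 1)) = d (d (d (gdSeq d u k))) - 4 * u * d (gdSeq d u k)
      - 2 * d u * gdSeq d u k := by
  have h := coeffDeriv_genQuad_self d u (PowerSeries.mk (gdSeq d u))
  rw [genQuad_gdSeq, Derivation.map_ofNat] at h
  have hT : (2 * PowerSeries.mk (gdSeq d u) : R⟦X⟧) ≠ 0 := by
    intro h0
    have h00 := congrArg (PowerSeries.coeff 0) h0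
    rw [← map_ofNat (PowerSeries.C (R := R)) 2, PowerSeries.coeff_C_mul, PowerSeries.coeff_mk,
      gdSeq_zero, map_zero] at h00
    have : (4 : R) * 1 = 4 * 0 := by linear_combination -h00
    exact one_ne_zero (ofNat_mul_cancel this)
  have h1 := (mul_eq_zero.mp h.symm).resolve_left hT
  have h2 := congrArg (PowerSeries.coeff (k + 1)) h1
  rw [← map_ofNat (PowerSeries.C (R := R)) 2, ← map_ofNat (PowerSeries.C (R := R)) 4, ← map_mul,
    ← map_mul] at h2
  simp only [map_sub, PowerSeries.coeff_C_mul, PowerSeries.coeff_succ_X_mul, coeffDeriv_mk,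
    PowerSeries.coeff_mk, map_zero] at h2
  linear_combination h2
end

theorem Hder_X (i : ℕ) : Hder (X i) = X (i + 1) :=
  mkDerivation_X (R := ℂ) (fun i => (X (i + 1) : HH)) i

theorem pderiv_succ_Hder (j : ℕ) (c : HH) :
    pderiv (j + 1) (Hder c) = Hder (pderiv (j + 1) c) + pderiv j c := by
  have : ⁅(pderiv (j + 1) : Derivation ℂ HH HH), Hder⁆ = pderiv j := by
    refine derivation_ext fun i => ?_
    rw [Derivation.commutator_apply, Hder_X, pderiv_X, pderiv_X, pderiv_X]
    have h : Hder (Pi.single (M := fun _ => HH) (j + 1) 1 i) = 0 := by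
      rw [Pi.single_apply]
      split_ifs <;> simp
    rw [h, sub_zero, Pi.single_apply, Pi.single_apply]
    simp
  rw [← this, Derivation.commutator_apply]
  ring

theorem exists_pderiv_eq_zero (s : Finset HH) :
    ∃ N : ℕ, ∀ c ∈ s, ∀ i, N ≤ i → pderiv i c = 0 := by
  refine ⟨(s.biUnion vars).sup id + 1, fun c hc i hi => pderiv_eq_zero_of_notMem_vars fun h => ?_⟩
  have := Finset.le_sup (f := id) (Finset.mem_biUnion.mpr ⟨c, hc, h⟩)
  simp only [id] at this
  omega

theorem eq_C_of_Hder_eq_zero {c : HH} (h : Hder c = 0) : c = C (constantCoeff c) := by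
  obtain ⟨N, hN⟩ := exists_pderiv_eq_zero {c}
  have hz : ∀ n j, N ≤ j + n → pderiv j c = 0 := by
    intro n
    induction n with
    | zero => exact fun j hj => hN c (Finset.mem_singleton_self c) j hj
    | succ n ih =>
      intro j hj
      have h1 := pderiv_succ_Hder j c
      rw [h, ih (j + 1) (by omega)] at h1
      simpa using h1.symm
  ext m
  rw [coeff_C]
  split_ifs with hm
  · rw [← hm]; rfl
  · obtain ⟨i, hi⟩ := Finsupp.ne_iff.mp (Ne.symm hm)
    have h1 := coeff_pderiv (i := i) c (m - Finsupp.single i 1)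
    rw [hz N i (by omega), coeff_zero,
      Finsupp.sub_add_single_one_cancel (by simpa using hi)] at h1
    have h2 : (((m - Finsupp.single i 1 : ℕ →₀ ℕ) i : ℕ) + 1 : ℂ) ≠ 0 := Nat.cast_add_one_ne_zero _
    exact (mul_eq_zero.mp h1.symm).resolve_right h2

/-- The augmentation ideal of ℋ. -/
def augIdeal : Ideal HH := RingHom.ker (constantCoeff : HH →+* ℂ)

theorem mem_augIdeal {c : HH} : c ∈ augIdeal ↔ constantCoeff c = 0 := Iff.rfl

theorem Hder_mem_augIdeal (c : HH) : Hder c ∈ augIdeal := by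
  rw [mem_augIdeal]
  induction c using MvPolynomial.induction_on with
  | C a => simp
  | add p q hp hq => simp [hp, hq]
  | mul_X p i hp => simp [Hder_X, hp]

theorem eq_zero_of_Hder_eq_zero {c : HH} (hc : c ∈ augIdeal) (h : Hder c = 0) : c = 0 := by
  rw [eq_C_of_Hder_eq_zero h, mem_augIdeal.mp hc, map_zero]

theorem Dop_apply (f : HH) : Dop f = Hder f := rfl

theorem mulH_apply (c f : HH) : mulH c f = c * f := rfl

theorem mulH_mul (a b : HH) : mulH (a * b) = mulH a * mulH b := by
  refine LinearMap.ext fun f => ?_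
  simp [mulH_apply, mul_assoc]

theorem mulH_add (a b : HH) : mulH (a + b) = mulH a + mulH b := by
  refine LinearMap.ext fun f => ?_
  simp [mulH_apply, add_mul]

theorem mulH_injective : Function.Injective mulH := fun a b h => by
  simpa [mulH_apply] using LinearMap.congr_fun h 1

theorem Dop_mul_mulH (c : HH) : Dop * mulH c = mulH (Hder c) + mulH c * Dop := by
  refine LinearMap.ext fun f => ?_
  simp only [Module.End.mul_apply, LinearMap.add_apply, mulH_apply, Dop_apply, Derivation.leibniz,
    smul_eq_mul]
  ring

/-- The differential operators of order at most `n` with coefficients in `I`. -/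
def diffOps (I : Ideal HH) (n : ℕ) : AddSubgroup (Module.End ℂ HH) :=
  AddSubgroup.closure {T | ∃ c ∈ I, ∃ i ≤ n, T = mulH c * Dop ^ i}

theorem mulH_mul_Dop_pow_mem {I : Ideal HH} {c : HH} (hc : c ∈ I) {i n : ℕ} (hi : i ≤ n) :
    mulH c * Dop ^ i ∈ diffOps I n :=
  AddSubgroup.subset_closure ⟨c, hc, i, hi, rfl⟩

theorem diffOps_induction {I : Ideal HH} {n : ℕ} {K : AddSubgroup (Module.End ℂ HH)}
    (F : Module.End ℂ HH →+ Module.End ℂ HH)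
    (h : ∀ c ∈ I, ∀ i ≤ n, F (mulH c * Dop ^ i) ∈ K)
    {T : Module.End ℂ HH} (hT : T ∈ diffOps I n) : F T ∈ K := by
  have : diffOps I n ≤ K.comap F := by
    refine (AddSubgroup.closure_le _).mpr ?_
    rintro _ ⟨c, hc, i, hi, rfl⟩
    exact h c hc i hi
  exact this hT

theorem diffOps_mono (I : Ideal HH) {m n : ℕ} (h : m ≤ n) : diffOps I m ≤ diffOps I n := fun _ =>
  diffOps_induction (AddMonoidHom.id _) fun _ hc _ hi => mulH_mul_Dop_pow_mem hc (hi.trans h)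

theorem mulH_mul_mem {I : Ideal HH} {n : ℕ} (a : HH) {T : Module.End ℂ HH}
    (hT : T ∈ diffOps I n) : mulH a * T ∈ diffOps I n :=
  diffOps_induction (AddMonoidHom.mulLeft _) (fun c hc i hi => by
    rw [AddMonoidHom.coe_mulLeft, ← mul_assoc, ← mulH_mul]
    exact mulH_mul_Dop_pow_mem (I.mul_mem_left a hc) hi) hT

theorem mul_Dop_mem {I : Ideal HH} {n : ℕ} {T : Module.End ℂ HH}
    (hT : T ∈ diffOps I n) : T * Dop ∈ diffOps I (n + 1) :=
  diffOps_induction (AddMonoidHom.mulRight _) (fun c hc i hi => by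
    rw [AddMonoidHom.mulRight_apply, mul_assoc, ← pow_succ]
    exact mulH_mul_Dop_pow_mem hc (by omega)) hT

theorem Dop_mul_mem {I : Ideal HH} (hI : ∀ c ∈ I, Hder c ∈ I) {n : ℕ} {T : Module.End ℂ HH}
    (hT : T ∈ diffOps I n) : Dop * T ∈ diffOps I (n + 1) :=
  diffOps_induction (AddMonoidHom.mulLeft _) (fun c hc i hi => by
    rw [AddMonoidHom.coe_mulLeft, ← mul_assoc, Dop_mul_mulH, add_mul, mul_assoc, ← pow_succ']
    exact add_mem (mulH_mul_Dop_pow_mem (hI c hc) (by omega))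
      (mulH_mul_Dop_pow_mem hc (by omega))) hT

theorem Dop_pow_mul_mulH_mem {I : Ideal HH} (hI : ∀ c ∈ I, Hder c ∈ I) {c : HH} (hc : c ∈ I)
    (n : ℕ) : Dop ^ n * mulH c ∈ diffOps I n := by
  induction n with
  | zero => simpa using mulH_mul_Dop_pow_mem hc (le_refl 0)
  | succ n ih =>
    rw [pow_succ', mul_assoc]
    exact Dop_mul_mem hI ih

theorem mul_mulH_mem {I J : Ideal HH} (hI : ∀ c ∈ I, Hder c ∈ I) {n : ℕ} {c : HH} (hc : c ∈ I)
    {T : Module.End ℂ HH} (hT : T ∈ diffOps J n) : T * mulH c ∈ diffOps I n :=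
  diffOps_induction (AddMonoidHom.mulRight _) (fun a _ i hi => by
    rw [AddMonoidHom.mulRight_apply, mul_assoc]
    exact mulH_mul_mem a (diffOps_mono I hi (Dop_pow_mul_mulH_mem hI hc i))) hT

/-- The differential operator with the given coefficients. -/
def ofCoeffs (p : Polynomial HH) : Module.End ℂ HH :=
  p.eval₂ (Algebra.lmul ℂ HH).toRingHom Dop

theorem ofCoeffs_add (p q : Polynomial HH) : ofCoeffs (p + q) = ofCoeffs p + ofCoeffs q :=
  Polynomial.eval₂_add ..

theorem ofCoeffs_neg (p : Polynomial HH) : ofCoeffs (-p) = -ofCoeffs p :=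
  Polynomial.eval₂_neg ..

theorem ofCoeffs_monomial (n : ℕ) (c : HH) :
    ofCoeffs (Polynomial.monomial n c) = mulH c * Dop ^ n :=
  Polynomial.eval₂_monomial ..

theorem ofCoeffs_mul_X (p : Polynomial HH) : ofCoeffs (p * Polynomial.X) = ofCoeffs p * Dop :=
  Polynomial.eval₂_mul_X ..

theorem ofCoeffs_C_mul (c : HH) (p : Polynomial HH) :
    ofCoeffs (Polynomial.C c * p) = mulH c * ofCoeffs p := by
  induction p using Polynomial.induction_on' with
  | add p q hp hq => rw [mul_add, ofCoeffs_add, hp, hq, ofCoeffs_add, mul_add]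
  | monomial n a =>
    rw [Polynomial.C_mul_monomial, ofCoeffs_monomial, ofCoeffs_monomial, mulH_mul, mul_assoc]

theorem exists_ofCoeffs {I : Ideal HH} {n : ℕ} {T : Module.End ℂ HH} (hT : T ∈ diffOps I n) :
    ∃ p : Polynomial HH, p.natDegree ≤ n ∧ (∀ i, p.coeff i ∈ I) ∧ ofCoeffs p = T := by
  refine AddSubgroup.closure_induction
    (p := fun T _ => ∃ p : Polynomial HH, p.natDegree ≤ n ∧ (∀ i, p.coeff i ∈ I) ∧ ofCoeffs p = T)
    ?_ ⟨0, by simp, by simp, by simp [ofCoeffs]⟩ ?_ ?_ hT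
  · rintro _ ⟨c, hc, i, hi, rfl⟩
    refine ⟨Polynomial.monomial i c, (Polynomial.natDegree_monomial_le c).trans hi, fun j => ?_,
      ofCoeffs_monomial i c⟩
    rw [Polynomial.coeff_monomial]
    split_ifs
    exacts [hc, I.zero_mem]
  · rintro _ _ _ _ ⟨p, hp, hp', rfl⟩ ⟨q, hq, hq', rfl⟩
    exact ⟨p + q, (Polynomial.natDegree_add_le p q).trans (max_le hp hq),
      fun i => by rw [Polynomial.coeff_add]; exact I.add_mem (hp' i) (hq' i), ofCoeffs_add p q⟩
  · rintro _ _ ⟨p, hp, hp', rfl⟩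
    refine ⟨-p, by rwa [Polynomial.natDegree_neg], fun i => ?_, ?_⟩
    · rw [Polynomial.coeff_neg]
      exact I.neg_mem (hp' i)
    · rw [eq_neg_iff_add_eq_zero, ← ofCoeffs_add]
      simp [ofCoeffs]

theorem coeff_eq_zero_of_ofCoeffs_eq_zero {p : Polynomial HH} (h : ofCoeffs p = 0) (n : ℕ) :
    p.coeff n = 0 := by
  obtain ⟨N, hN⟩ := exists_pderiv_eq_zero (p.support.image p.coeff)
  have hD : ∀ i, (Dop ^ i) (X N : HH) = X (N + i) := by
    intro i
    induction i with
    | zero => simp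
    | succ i ih => rw [pow_succ', Module.End.mul_apply, ih, Dop_apply, Hder_X, add_assoc]
  have h1 : ofCoeffs p (X N) = ∑ i ∈ p.support, p.coeff i * X (N + i) := by
    rw [ofCoeffs, Polynomial.eval₂_eq_sum, Polynomial.sum, LinearMap.sum_apply]
    exact Finset.sum_congr rfl fun i _ => by rw [Module.End.mul_apply, hD]; rfl
  have h2 := congrArg (pderiv (N + n)) h1
  rw [h, LinearMap.zero_apply, map_zero, map_sum] at h2
  by_contra hn
  rw [Finset.sum_eq_single n] at h2
  · rw [pderiv_mul, hN _ (Finset.mem_image_of_mem _ (Polynomial.mem_support_iff.mpr hn)) _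
      (by omega), pderiv_X_self] at h2
    exact hn (by simpa using h2.symm)
  · intro i hi hin
    rw [pderiv_mul, hN _ (Finset.mem_image_of_mem _ hi) _ (by omega), pderiv_X_of_ne (by omega)]
    simp
  · exact fun h => absurd (Polynomial.mem_support_iff.mpr hn) h

/-- The coefficientwise derivative of a polynomial over ℋ. -/
def coeffsDeriv (p : Polynomial HH) : Polynomial HH :=
  p.sum fun i c => Polynomial.monomial i (Hder c)

theorem coeffsDeriv_add (p q : Polynomial HH) :
    coeffsDeriv (p + q) = coeffsDeriv p + coeffsDeriv q :=
  Polynomial.sum_add_index _ _ _ (by simp) (by simp)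

theorem coeffsDeriv_monomial (n : ℕ) (c : HH) :
    coeffsDeriv (Polynomial.monomial n c) = Polynomial.monomial n (Hder c) :=
  Polynomial.sum_monomial_index _ _ (by simp)

theorem coeff_coeffsDeriv (p : Polynomial HH) (n : ℕ) :
    (coeffsDeriv p).coeff n = Hder (p.coeff n) := by
  induction p using Polynomial.induction_on' with
  | add p q hp hq => rw [coeffsDeriv_add, Polynomial.coeff_add, hp, hq, Polynomial.coeff_add,
    map_add]
  | monomial m a =>
    rw [coeffsDeriv_monomial, Polynomial.coeff_monomial, Polynomial.coeff_monomial]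
    split_ifs <;> simp

theorem coeffsDeriv_mul_X (p : Polynomial HH) :
    coeffsDeriv (p * Polynomial.X) = coeffsDeriv p * Polynomial.X := by
  ext1 n
  cases n <;> simp [coeff_coeffsDeriv, Polynomial.coeff_mul_X]

theorem Dop_mul_ofCoeffs (p : Polynomial HH) :
    Dop * ofCoeffs p = ofCoeffs (p * Polynomial.X + coeffsDeriv p) := by
  induction p using Polynomial.induction_on' with
  | add p q hp hq =>
    rw [coeffsDeriv_add, ofCoeffs_add, mul_add, hp, hq, ← ofCoeffs_add]
    congr 1
    ring
  | monomial m a =>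
    rw [coeffsDeriv_monomial, ofCoeffs_add, ofCoeffs_mul_X, ofCoeffs_monomial, ofCoeffs_monomial,
      ← mul_assoc, Dop_mul_mulH, add_mul, mul_assoc, mul_assoc, ← pow_succ, ← pow_succ', add_comm]

theorem eq_zero_of_lie_LopH {n : ℕ} {T : Module.End ℂ HH} (hT : T ∈ diffOps augIdeal n) {r : HH}
    (h : ⁅LopH, T⁆ = mulH r) : T = 0 := by
  obtain ⟨p, -, hp, rfl⟩ := exists_ofCoeffs hT
  have htop : ofCoeffs p ∈ diffOps ⊤ p.natDegree := by
    rw [ofCoeffs, Polynomial.eval₂_eq_sum_range]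
    exact sum_mem fun i hi => mulH_mul_Dop_pow_mem Submodule.mem_top (Finset.mem_range_succ_iff.mp
      hi)
  obtain ⟨q, hq, -, hq'⟩ := exists_ofCoeffs
    (mul_mulH_mem (I := ⊤) (fun _ _ => Submodule.mem_top) (c := X 0) Submodule.mem_top htop)
  have key : ofCoeffs (2 * coeffsDeriv p * Polynomial.X + coeffsDeriv (coeffsDeriv p) + q
      + (-(Polynomial.C (X 0) * p) - Polynomial.C r)) = 0 := by
    have e1 : Dop ^ 2 * ofCoeffs p = ofCoeffs (p * Polynomial.X * Polynomial.X
        + 2 * coeffsDeriv p * Polynomial.X + coeffsDeriv (coeffsDeriv p)) := by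
      rw [pow_two, mul_assoc, Dop_mul_ofCoeffs, Dop_mul_ofCoeffs, coeffsDeriv_add,
        coeffsDeriv_mul_X]
      congr 1
      ring
    have e2 : ofCoeffs p * Dop ^ 2 = ofCoeffs (p * Polynomial.X * Polynomial.X) := by
      rw [pow_two, ← mul_assoc, ofCoeffs_mul_X, ofCoeffs_mul_X]
    have e3 : ofCoeffs (Polynomial.C r) = mulH r := by
      simpa using ofCoeffs_monomial 0 r
    rw [Ring.lie_def, LopH, sub_mul, mul_sub, e1, e2, ← hq', ← ofCoeffs_C_mul, ← e3] at h
    simp only [sub_eq_add_neg, ← ofCoeffs_neg, ← ofCoeffs_add, neg_add, neg_neg] at h ⊢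
    rw [← sub_eq_zero, sub_eq_add_neg, ← ofCoeffs_neg, ← ofCoeffs_add] at h
    rw [← h]
    congr 1
    ring
  have h1 := coeff_eq_zero_of_ofCoeffs_eq_zero key (p.natDegree + 1)
  have h2 : p.coeff (p.natDegree + 1) = 0 :=
    Polynomial.coeff_eq_zero_of_natDegree_lt (Nat.lt_succ_self _)
  rw [← map_ofNat Polynomial.C 2, mul_assoc] at h1
  simp only [Polynomial.coeff_add, Polynomial.coeff_sub, Polynomial.coeff_neg,
    Polynomial.coeff_C_mul, Polynomial.coeff_mul_X, coeff_coeffsDeriv, h2,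
    Polynomial.coeff_C_succ, map_zero, mul_zero,
    Polynomial.coeff_eq_zero_of_natDegree_lt (Nat.lt_succ_of_le hq)] at h1
  have h3 : p.leadingCoeff = 0 := eq_zero_of_Hder_eq_zero (hp _) (by simpa using h1)
  rw [Polynomial.leadingCoeff_eq_zero.mp h3]
  simp [ofCoeffs]

theorem lie_LopH_add (S T : Module.End ℂ HH) : ⁅LopH, S + T⁆ = ⁅LopH, S⁆ + ⁅LopH, T⁆ := by
  simp only [Ring.lie_def, mul_add, add_mul]
  abel

theorem lie_LopH_sub (S T : Module.End ℂ HH) : ⁅LopH, S - T⁆ = ⁅LopH, S⁆ - ⁅LopH, T⁆ := by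
  simp only [Ring.lie_def, mul_sub, sub_mul]
  abel

theorem lie_LopH_first_order (w : HH) :
    ⁅LopH, mulH (Hder w) - 2 * (mulH w * Dop)⁆ =
      mulH (Hder (Hder (Hder w)) - 4 * X 0 * Hder w - 2 * Hder (X 0) * w)
        - 4 * (mulH (Hder w) * LopH) := by
  refine LinearMap.ext fun f => ?_
  have h2 : ∀ T : Module.End ℂ HH, (2 * T) f = 2 * T f := fun T => by
    rw [two_mul, two_mul]; rfl
  have h4 : ∀ T : Module.End ℂ HH, (4 * T) f = 4 * T f := fun T => by
    rw [← two_add_two_eq_four, ← two_add_two_eq_four, add_mul, add_mul, LinearMap.add_apply, h2]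
  simp only [Ring.lie_def, LopH, LinearMap.sub_apply, Module.End.mul_apply, pow_two, mulH_apply,
    Dop_apply, h4, map_sub, Derivation.leibniz, smul_eq_mul, two_mul, LinearMap.add_apply, map_add]
  ring

theorem gdSeq_one : gdSeq Hder (X 0) 1 = X 0 := by
  apply ofNat_mul_cancel (n := 16)
  rw [gdSeq_succ Hder (X 0) 0]
  simp [gdSeq_zero, Derivation.map_ofNat]
  ring

theorem gdSeq_succ_mem_augIdeal (k : ℕ) : gdSeq Hder (X 0) (k + 1) ∈ augIdeal := by
  induction k using Nat.strong_induction_on with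
  | _ k ih =>
    have h : (16 : HH) * gdSeq Hder (X 0) (k + 1) ∈ augIdeal := by
      rw [gdSeq_succ]
      refine add_mem (sum_mem fun i _ => add_mem (sub_mem ?_ ?_) ?_)
        (Ideal.mul_mem_left _ _ (sum_mem fun i hi => ?_))
      · exact Ideal.mul_mem_left _ _ (Hder_mem_augIdeal _)
      · exact Ideal.mul_mem_right _ _ (Ideal.mul_mem_left _ _ (Hder_mem_augIdeal _))
      · refine Ideal.mul_mem_right _ _ (Ideal.mul_mem_right _ _ (Ideal.mul_mem_left _ _ ?_))
        simp [mem_augIdeal]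
      · exact Ideal.mul_mem_right _ _ (ih i (Finset.mem_range.mp hi))
    rw [mem_augIdeal, map_mul, map_ofNat] at h
    exact (mul_eq_zero.mp h).resolve_left (by norm_num)

theorem exists_lie_LopH_eq (k : ℕ) : ∃ A : Module.End ℂ HH,
    A - Dop ^ (2 * k + 1) ∈ diffOps augIdeal (2 * k + 1) ∧
      ⁅LopH, A⁆ = mulH (Hder (gdSeq Hder (X 0) (k + 1))) := by
  induction k with
  | zero =>
    refine ⟨Dop, by simp, ?_⟩
    rw [gdSeq_one, Ring.lie_def, LopH, sub_mul, mul_sub, Dop_mul_mulH, ← pow_succ, ← pow_succ']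
    abel
  | succ k ih =>
    obtain ⟨A, hA, hL⟩ := ih
    have hX : (X 0 : HH) ∈ augIdeal := by simp [mem_augIdeal]
    have hI : ∀ c ∈ augIdeal, Hder c ∈ augIdeal := fun c _ => Hder_mem_augIdeal c
    obtain ⟨w, hw⟩ : ∃ w, 4 * w = gdSeq Hder (X 0) (k + 1) := by
      refine ⟨C (1 / 4) * gdSeq Hder (X 0) (k + 1), ?_⟩
      rw [← mul_assoc, ← map_ofNat C 4, ← C_mul]
      norm_num
    have hwI : w ∈ augIdeal := by
      have h := gdSeq_succ_mem_augIdeal k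
      rw [← hw, mem_augIdeal, map_mul, map_ofNat] at h
      exact (mul_eq_zero.mp h).resolve_left (by norm_num)
    refine ⟨A * LopH + (mulH (Hder w) - 2 * (mulH w * Dop)), ?_, ?_⟩
    · have e : A * LopH + (mulH (Hder w) - 2 * (mulH w * Dop)) - Dop ^ (2 * (k + 1) + 1) =
          (A - Dop ^ (2 * k + 1)) * Dop * Dop - (A - Dop ^ (2 * k + 1)) * mulH (X 0)
            - Dop ^ (2 * k + 1) * mulH (X 0)
            + (mulH (Hder w) * Dop ^ 0 - (mulH w * Dop ^ 1 + mulH w * Dop ^ 1)) := by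
        rw [LopH, two_mul (mulH w * Dop), show 2 * (k + 1) + 1 = 2 * k + 1 + 2 by ring, pow_add]
        generalize Dop ^ (2 * k + 1) = P
        generalize mulH (X 0) = x
        rw [pow_zero, pow_one, mul_one, mul_sub, sub_mul, sub_mul, sub_mul, mul_assoc A,
          mul_assoc P,
          ← pow_two]
        abel
      rw [e]
      have hw1 : mulH w * Dop ^ 1 ∈ diffOps augIdeal (2 * (k + 1) + 1) :=
        mulH_mul_Dop_pow_mem hwI (by omega)
      exact add_mem (sub_mem (sub_mem (mul_Dop_mem (mul_Dop_mem hA))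
        (diffOps_mono _ (by omega) (mul_mulH_mem hI hX hA)))
        (diffOps_mono _ (by omega) (Dop_pow_mul_mulH_mem hI hX _)))
        (sub_mem (mulH_mul_Dop_pow_mem (Hder_mem_augIdeal w) (by omega)) (add_mem hw1 hw1))
    · have e : ⁅LopH, A * LopH⁆ = ⁅LopH, A⁆ * LopH := by
        simp only [Ring.lie_def, sub_mul, mul_assoc]
      have h1 : Hder (gdSeq Hder (X 0) (k + 1 + 1)) =
          Hder (Hder (Hder w)) - 4 * X 0 * Hder w - 2 * Hder (X 0) * w := by
        apply ofNat_mul_cancel (n := 4)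
        rw [deriv_gdSeq_succ, ← hw]
        simp only [Derivation.leibniz, Derivation.map_ofNat, smul_eq_mul, mul_zero, add_zero]
        ring
      have h4 : mulH (4 * Hder w) = 4 * mulH (Hder w) := by
        rw [show 4 * Hder w = Hder w + Hder w + (Hder w + Hder w) by ring, mulH_add, mulH_add,
          ← two_add_two_eq_four, add_mul, two_mul]
      rw [lie_LopH_add, e, hL, lie_LopH_first_order, h1, ← hw]
      simp only [Derivation.leibniz, Derivation.map_ofNat, smul_eq_mul, mul_zero, add_zero, h4]
      noncomm_ring

theorem eq_Hder_gdSeq (r : ℕ → HH) (hr0 : r 0 = X 1)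
    (hr : ∀ k, 1 ≤ k → ∃ α : Fin k → HH,
      (∀ j : Fin k, (α j).IsWeightedHomogeneous wtH (2 * ((j : ℕ) + 1))) ∧
      ⁅LopH, AopH k α⁆ = mulH (r k)) (k : ℕ) : r k = Hder (gdSeq Hder (X 0) (k + 1)) := by
  rcases Nat.eq_zero_or_pos k with rfl | hk
  · rw [hr0, gdSeq_one, Hder_X]
  · obtain ⟨α, hα, h⟩ := hr k hk
    obtain ⟨A, hA, hL⟩ := exists_lie_LopH_eq k
    have hI : ∀ c ∈ augIdeal, Hder c ∈ augIdeal := fun c _ => Hder_mem_augIdeal c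
    have hα' : ∀ j, α j ∈ augIdeal := by
      intro j
      by_contra hj
      have := hα j hj
      simp at this
    have hmem : AopH k α - Dop ^ (2 * k + 1) ∈ diffOps augIdeal (2 * k + 1) := by
      rw [AopH, add_sub_cancel_left]
      exact sum_mem fun j _ => add_mem (mulH_mul_Dop_pow_mem (hα' j) (by omega))
        (diffOps_mono _ (by omega) (Dop_pow_mul_mulH_mem hI (hα' j) _))
    have hmem' := sub_mem hmem hA
    rw [sub_sub_sub_cancel_right] at hmem'
    have h0 := eq_zero_of_lie_LopH hmem' (r := r k - Hder (gdSeq Hder (X 0) (k + 1))) (by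
      rw [lie_LopH_sub, h, hL]
      refine LinearMap.ext fun f => ?_
      simp [mulH_apply, sub_mul])
    apply mulH_injective
    rw [← h, ← hL, sub_eq_zero.mp h0]

section

/-- The direction of differentiation of `pd g m`. -/
def coordDir (g m : ℕ) : Fin g → ℂ :=
  if h : 1 ≤ m ∧ m - 1 < g then Pi.single (⟨m - 1, h.2⟩ : Fin g) 1 else 0

theorem pd_eq_fderiv (g m : ℕ) (f : (Fin g → ℂ) → ℂ) (t : Fin g → ℂ) :
    pd g m f t = fderiv ℂ f t (coordDir g m) := by
  unfold pd coordDir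
  split_ifs <;> simp

theorem pd_of_lt {g m : ℕ} (h : g < m) (f : (Fin g → ℂ) → ℂ) : pd g m f = 0 := by
  ext t
  rw [pd, dif_neg (by omega), Pi.zero_apply]

variable {g : ℕ} {Ω : Set (Fin g → ℂ)}

theorem AnalyticOnNhd.pd {f : (Fin g → ℂ) → ℂ} (hf : AnalyticOnNhd ℂ f Ω) (m : ℕ) :
    AnalyticOnNhd ℂ (pd g m f) Ω := by
  have h := (ContinuousLinearMap.apply ℂ ℂ (coordDir g m)).comp_analyticOnNhd hf.fderiv
  exact (funext fun t => pd_eq_fderiv g m f t) ▸ h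

theorem AnalyticOnNhd.pd_iterate {f : (Fin g → ℂ) → ℂ} (hf : AnalyticOnNhd ℂ f Ω) (m n : ℕ) :
    AnalyticOnNhd ℂ ((_root_.pd g m)^[n] f) Ω := by
  induction n with
  | zero => exact hf
  | succ n ih =>
    rw [Function.iterate_succ_apply']
    exact ih.pd m

theorem pd_comm {f : (Fin g → ℂ) → ℂ} (hf : AnalyticOnNhd ℂ f Ω) (i j : ℕ) {t : Fin g → ℂ}
    (ht : t ∈ Ω) : pd g i (pd g j f) t = pd g j (pd g i f) t := by
  have h : ∀ i j, pd g i (pd g j f) t = fderiv ℂ (fderiv ℂ f) t (coordDir g i) (coordDir g j) := by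
    intro i j
    rw [pd_eq_fderiv, funext fun s => pd_eq_fderiv g j f s,
      fderiv_clm_apply (hf.fderiv t ht).differentiableAt (differentiableAt_const _)]
    simp
  rw [h, h]
  exact (hf t ht).contDiffAt.isSymmSndFDerivAt_of_omega _ _

theorem pd_congr (hΩ : IsOpen Ω) {f h : (Fin g → ℂ) → ℂ} (hfh : Set.EqOn f h Ω) (m : ℕ) :
    Set.EqOn (pd g m f) (pd g m h) Ω := fun t ht => by
  rw [pd_eq_fderiv, pd_eq_fderiv, (hfh.eventuallyEq_of_mem (hΩ.mem_nhds ht)).fderiv_eq]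

/-- The subalgebra of holomorphic functions among all functions on `Ω`. -/
def holoSubalgebra (Ω : Set (Fin g → ℂ)) : Subalgebra ℂ (Ω → ℂ) where
  carrier := {f | ∃ F : (Fin g → ℂ) → ℂ, AnalyticOnNhd ℂ F Ω ∧ ∀ t : Ω, F t = f t}
  mul_mem' := by
    rintro _ _ ⟨F, hF, hF'⟩ ⟨G, hG, hG'⟩
    exact ⟨F * G, hF.mul hG, fun t => by simp [hF', hG']⟩
  add_mem' := by
    rintro _ _ ⟨F, hF, hF'⟩ ⟨G, hG, hG'⟩
    exact ⟨F + G, hF.add hG, fun t => by simp [hF', hG']⟩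
  algebraMap_mem' c := ⟨fun _ => c, analyticOnNhd_const, fun _ => rfl⟩

/-- The algebra of holomorphic functions on `Ω`. -/
def Holo (Ω : Set (Fin g → ℂ)) : Type := holoSubalgebra Ω

instance : CommRing (Holo Ω) := inferInstanceAs (CommRing (holoSubalgebra Ω))

instance : Algebra ℂ (Holo Ω) := inferInstanceAs (Algebra ℂ (holoSubalgebra Ω))

/-- Evaluation of holomorphic functions at a point. -/
def evalHolo (t : Ω) : Holo Ω →+* ℂ :=
  (Pi.evalRingHom (fun _ : Ω => ℂ) t).comp (holoSubalgebra Ω).val.toRingHom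

theorem evalHolo_algebraMap (t : Ω) (c : ℂ) : evalHolo t (algebraMap ℂ (Holo Ω) c) = c := rfl

theorem holo_ext {f h : Holo Ω} (e : ∀ t, evalHolo t f = evalHolo t h) : f = h :=
  Subtype.ext (funext e)

/-- The restriction of a function holomorphic on `Ω`. -/
def resHolo (f : (Fin g → ℂ) → ℂ) (hf : AnalyticOnNhd ℂ f Ω) : Holo Ω :=
  ⟨fun t => f t, f, hf, fun _ => rfl⟩

theorem evalHolo_resHolo (t : Ω) (f : (Fin g → ℂ) → ℂ) (hf : AnalyticOnNhd ℂ f Ω) :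
    evalHolo t (resHolo f hf) = f t := rfl

theorem resHolo_congr {f h : (Fin g → ℂ) → ℂ} {hf : AnalyticOnNhd ℂ f Ω}
    {hh : AnalyticOnNhd ℂ h Ω} : resHolo f hf = resHolo h hh ↔ Set.EqOn f h Ω := by
  refine ⟨fun e t ht => congrFun (congrArg Subtype.val e) ⟨t, ht⟩, fun e => ?_⟩
  refine holo_ext fun t => ?_
  exact e t.2

theorem exists_resHolo (f : Holo Ω) : ∃ F, ∃ hF : AnalyticOnNhd ℂ F Ω, resHolo F hF = f := by
  obtain ⟨f, F, hF, h⟩ := f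
  exact ⟨F, hF, by exact holo_ext h⟩

/-- The partial derivatives as derivations of the algebra of holomorphic functions. -/
def holoDeriv (hΩ : IsOpen Ω) (m : ℕ) : Derivation ℂ (Holo Ω) (Holo Ω) :=
  have hd : ∀ (f : Holo Ω) (t : Ω), DifferentiableAt ℂ (exists_resHolo f).choose t := fun f t =>
    ((exists_resHolo f).choose_spec.choose t t.2).differentiableAt
  have hr : ∀ (f : Holo Ω) (t : Fin g → ℂ) (ht : t ∈ Ω), (exists_resHolo f).choose t = f.1 ⟨t,
      ht⟩ :=
    fun f t ht => congrFun (congrArg Subtype.val (exists_resHolo f).choose_spec.choose_spec) ⟨t, ht⟩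
  Derivation.mk'
    { toFun := fun f => resHolo (pd g m (exists_resHolo f).choose)
        ((exists_resHolo f).choose_spec.choose.pd m)
      map_add' := fun f h => by
        refine holo_ext fun t => ?_
        refine (pd_congr (h := (exists_resHolo f).choose + (exists_resHolo h).choose) hΩ
          (fun s hs => ?_) m t.2).trans ?_
        · rw [Pi.add_apply, hr _ s hs, hr _ s hs, hr _ s hs]
          rfl
        · rw [pd_eq_fderiv, fderiv_add (hd f t) (hd h t), _root_.add_apply,
            ← pd_eq_fderiv, ← pd_eq_fderiv]
          rfl
      map_smul' := fun c f => by
        refine holo_ext fun t => ?_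
        refine (pd_congr (h := c • (exists_resHolo f).choose) hΩ (fun s hs => ?_) m t.2).trans ?_
        · rw [Pi.smul_apply, hr _ s hs, hr _ s hs]
          rfl
        · rw [pd_eq_fderiv, fderiv_const_smul (hd f t), _root_.smul_apply,
            ← pd_eq_fderiv]
          rfl }
    (fun f h => by
      refine holo_ext fun t => ?_
      refine (pd_congr (h := (exists_resHolo f).choose * (exists_resHolo h).choose) hΩ
        (fun s hs => ?_) m t.2).trans ?_
      · rw [Pi.mul_apply, hr _ s hs, hr _ s hs, hr _ s hs]
        rfl
      · rw [pd_eq_fderiv, fderiv_mul (hd f t) (hd h t), _root_.add_apply,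
          _root_.smul_apply, _root_.smul_apply, ← pd_eq_fderiv,
          ← pd_eq_fderiv, hr _ t t.2, hr _ t t.2]
        rfl)

theorem holoDeriv_resHolo (hΩ : IsOpen Ω) (m : ℕ) (f : (Fin g → ℂ) → ℂ)
    (hf : AnalyticOnNhd ℂ f Ω) : holoDeriv hΩ m (resHolo f hf) = resHolo (pd g m f) (hf.pd m) := by
  refine (resHolo_congr (hf := (exists_resHolo (resHolo f hf)).choose_spec.choose.pd m)).mpr
    (pd_congr hΩ ?_ m)
  exact resHolo_congr.mp (exists_resHolo (resHolo f hf)).choose_spec.choose_spec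

theorem holoDeriv_comm (hΩ : IsOpen Ω) (i j : ℕ) (f : Holo Ω) :
    holoDeriv hΩ i (holoDeriv hΩ j f) = holoDeriv hΩ j (holoDeriv hΩ i f) := by
  obtain ⟨F, hF, rfl⟩ := exists_resHolo f
  simp only [holoDeriv_resHolo]
  exact resHolo_congr.mpr fun t ht => pd_comm hF i j ht

theorem holoDeriv_of_lt (hΩ : IsOpen Ω) {m : ℕ} (h : g < m) (f : Holo Ω) :
    holoDeriv hΩ m f = 0 := by
  obtain ⟨F, hF, rfl⟩ := exists_resHolo f
  rw [holoDeriv_resHolo]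
  refine holo_ext fun t => ?_
  exact congrFun (pd_of_lt h F) t

theorem exists_holoDeriv_one_eq_one (hΩ : IsOpen Ω) (hg : 1 ≤ g) :
    ∃ x : Holo Ω, holoDeriv hΩ 1 x = 1 := by
  let p : (Fin g → ℂ) →L[ℂ] ℂ := ContinuousLinearMap.proj ⟨0, hg⟩
  refine ⟨resHolo p (p.analyticOnNhd Ω), ?_⟩
  rw [holoDeriv_resHolo]
  refine holo_ext fun t => ?_
  change pd g 1 p t = 1
  rw [pd_eq_fderiv, p.fderiv, coordDir, dif_pos ⟨le_refl 1, by omega⟩]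
  simp [p]

theorem eq_algebraMap_of_holoDeriv_eq_zero (hΩ : IsOpen Ω) (hconn : IsConnected Ω) (f : Holo Ω)
    (h : ∀ m, 1 ≤ m → m ≤ g → holoDeriv hΩ m f = 0) : ∃ c : ℂ, f = algebraMap ℂ (Holo Ω) c := by
  obtain ⟨F, hF, rfl⟩ := exists_resHolo f
  obtain ⟨c, hc⟩ := hΩ.exists_is_const_of_fderiv_eq_zero hconn.isPreconnected
    hF.differentiableOn (fun t ht => by
      refine ContinuousLinearMap.coe_injective
        (LinearMap.pi_ext' fun i => LinearMap.ext_ring ?_)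
      have h1 := h (i + 1) (by omega) (by omega)
      rw [holoDeriv_resHolo] at h1
      have h2 : pd g (i + 1) F t = 0 := congrFun (congrArg Subtype.val h1) ⟨t, ht⟩
      rw [pd_eq_fderiv, coordDir, dif_pos ⟨by omega, by omega⟩] at h2
      simpa using h2)
  refine ⟨c, ?_⟩
  refine holo_ext fun t => ?_
  exact hc t t.2

end

section

open scoped PowerSeries

section
variable {R : Type*} [CommRing R] [Algebra ℂ R]

/-- The relations imposed on a sequence `V` with `V 0 = -2` by the commutation of the operators
attached to it. -/
theorem relations_of_commute (D : ℕ → Derivation ℂ R R)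
    (hD : ∀ i j f, D i (D j f) = D j (D i f)) (V : ℕ → R) (g : ℕ) (hV : V 0 = -2)
    (hVg : ∀ m, g < m → V m = 0) (hDg : ∀ m, g < m → ∀ f, D m f = 0) (x : R) (hx : D 1 x = 1)
    (hs : ∀ k, 1 ≤ k → k ≤ g → ∀ f, schr D V (bsOp D V k f) = bsOp D V k (schr D V f))
    (hb : ∀ k l, 1 ≤ k → k ≤ g → 1 ≤ l → l ≤ g → ∀ f,
      bsOp D V k (bsOp D V l f) = bsOp D V l (bsOp D V k f)) :
    (∀ k, 1 ≤ k → D k (V 1) = D 1 (V k)) ∧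
    (∀ k, 4 * D 1 (V (k + 1)) =
      D 1 (D 1 (D 1 (V k))) - 4 * V 1 * D 1 (V k) - 2 * D 1 (V 1) * V k) ∧
    ∀ l, 1 ≤ l → l ≤ g → ∀ k,
      2 * (D l (V (k + 1)) - D (l + 1) (V k)) = V l * D 1 (V k) - V k * D 1 (V l) := by
  have h1 : ∀ k, 1 ≤ k → D k (V 1) = D 1 (V k) := by
    intro k hk
    rcases le_or_gt k g with h | h
    · exact (commute_schr D hD V k x hx (hs k hk h)).1
    · rw [hDg k h, hVg k h, map_zero]
  refine ⟨h1, fun k => ?_, fun l hl hlg k => ?_⟩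
  · rcases Nat.eq_zero_or_pos k with rfl | hk
    · simp only [hV, map_neg, Derivation.map_ofNat, map_zero, neg_zero]
      ring
    · rcases le_or_gt k g with h | h
      · rw [← h1 (k + 1) (by omega), (commute_schr D hD V k x hx (hs k hk h)).2]
        ring
      · simp [hVg k h, hVg (k + 1) (by omega)]
  · rcases Nat.eq_zero_or_pos k with rfl | hk
    · simp only [hV, map_neg, Derivation.map_ofNat, neg_zero, zero_add, h1 l hl]
      ring
    · rcases le_or_gt k g with h | h
      · have e : D l (V (k + 1)) = D (k + 1) (V l) := by
          rcases le_or_gt (k + 1) g with h' | h'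
          · exact (commute_bsOp D hD V l (k + 1) x hx (hs l hl hlg) (hs _ (by omega) h')
              (hb l (k + 1) hl hlg (by omega) h')).1
          · rw [hVg _ h', hDg _ h', map_zero]
        rw [e]
        exact (commute_bsOp D hD V k l x hx (hs k hk h) (hs l hl hlg) (hb k l hk h hl hlg)).2
      · simp [hVg k h, hVg (k + 1) (by omega)]

theorem coeffDeriv_genQuad_eq_zero (D : ℕ → Derivation ℂ R R)
    (hD : ∀ i j f, D i (D j f) = D j (D i f)) (V : ℕ → R) (g : ℕ) (hV : V 0 = -2)
    (hDg : ∀ m, g < m → ∀ f, D m f = 0)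
    (h1 : ∀ k, 1 ≤ k → D k (V 1) = D 1 (V k))
    (hlin : ∀ k, 4 * D 1 (V (k + 1)) =
      D 1 (D 1 (D 1 (V k))) - 4 * V 1 * D 1 (V k) - 2 * D 1 (V 1) * V k)
    (hrel : ∀ l, 1 ≤ l → l ≤ g → ∀ k,
      2 * (D l (V (k + 1)) - D (l + 1) (V k)) = V l * D 1 (V k) - V k * D 1 (V l))
    (l : ℕ) (hl : 1 ≤ l) : coeffDeriv (D l) (genQuad (D 1) (V 1) (PowerSeries.mk V)) = 0 := by
  rcases le_or_gt l g with h | h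
  · induction h using Nat.decreasingInduction with
    | self =>
      rw [coeffDeriv_genQuad D hD V hV hlin g (h1 g hl) (h1 _ (by omega)) (hrel g hl le_rfl)]
      ext n
      cases n <;> simp [PowerSeries.coeff_succ_X_mul, hDg]
    | of_succ l hlg ih =>
      rw [coeffDeriv_genQuad D hD V hV hlin l (h1 l hl) (h1 _ (by omega)) (hrel l hl (by omega)),
        ih (by omega), mul_zero]
  · ext n
    simp [hDg l h]

theorem coeff_zero_genQuad (d : Derivation ℂ R R) (V : ℕ → R) (hV : V 0 = -2) (u : R) :
    PowerSeries.coeff 0 (genQuad d u (PowerSeries.mk V)) = 16 := by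
  simp [genQuad, hV, map_ofNat]
  norm_num

theorem coeff_one_genQuad (d : Derivation ℂ R R) (V : ℕ → R) (hV : V 0 = -2) :
    PowerSeries.coeff 1 (genQuad d (V 1) (PowerSeries.mk V)) = 0 := by
  rw [← zero_add 1, coeff_succ_genQuad d _ V hV 0]
  simp [hV, Derivation.map_ofNat]
  ring

theorem coeff_genQuad_eq_zero (d : Derivation ℂ R R) (V : ℕ → R) (hV : V 0 = -2) (u : R)
    {g : ℕ} (hVg : ∀ m, g < m → V m = 0) {n : ℕ} (hn : 2 * g + 1 < n) :
    PowerSeries.coeff n (genQuad d u (PowerSeries.mk V)) = 0 := by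
  obtain ⟨n, rfl⟩ := Nat.exists_eq_add_one_of_ne_zero (by omega : n ≠ 0)
  rw [coeff_succ_genQuad d _ V hV, hVg (n + 1) (by omega), mul_zero, sub_zero,
    Finset.sum_eq_zero, Finset.sum_eq_zero, mul_zero, add_zero]
  · intro i _
    rcases le_or_gt i g with h | h
    · rw [hVg (n - i) (by omega), mul_zero]
    · rw [hVg (i + 1) (by omega), zero_mul]
  · intro i _
    rcases le_or_gt i g with h | h
    · rw [hVg (n - i) (by omega)]
      simp
    · rw [hVg i h]
      simp

theorem eq_mul_gdSeq (d : Derivation ℂ R R) (u : R) (V : ℕ → R) (hV : V 0 = -2)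
    (α : ℂ⟦X⟧) (hα : PowerSeries.constantCoeff α = 1)
    (h : genQuad d u (PowerSeries.mk V) = PowerSeries.map (algebraMap ℂ R) (16 * α ^ 2)) :
    PowerSeries.mk V =
      PowerSeries.map (algebraMap ℂ R) α * PowerSeries.mk (gdSeq d u) := by
  have hinv : α * α⁻¹ = 1 := PowerSeries.mul_inv_cancel α (by rw [hα]; exact one_ne_zero)
  have hm : PowerSeries.map (algebraMap ℂ R) α * PowerSeries.map (algebraMap ℂ R) α⁻¹ = 1 := by
    rw [← map_mul, hinv, map_one]
  have hd : coeffDeriv d (PowerSeries.map (algebraMap ℂ R) α⁻¹) = 0 := by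
    ext n
    simp
  set A := PowerSeries.map (algebraMap ℂ R) α
  set B := PowerSeries.map (algebraMap ℂ R) α⁻¹
  have hq : genQuad d u (B * PowerSeries.mk V) = 16 := by
    have e : genQuad d u (B * PowerSeries.mk V) = B ^ 2 * genQuad d u (PowerSeries.mk V) := by
      simp only [genQuad, Derivation.leibniz, smul_eq_mul, hd, mul_zero, add_zero]
      ring
    rw [e, h, map_mul, map_pow, map_ofNat]
    linear_combination 16 * (A * B + 1) * hm
  have hc : (PowerSeries.mk fun n => PowerSeries.coeff n (B * PowerSeries.mk V)) =
      B * PowerSeries.mk V := by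
    ext n
    simp
  have hgd : B * PowerSeries.mk V = PowerSeries.mk (gdSeq d u) := by
    rw [← hc]
    congr 1
    funext n
    refine eq_gdSeq d u _ ?_ (by rw [hc, hq]) n
    simp [B, PowerSeries.coeff_mul, hV, hα]
  rw [← hgd, ← mul_assoc, hm, one_mul]

end

theorem sq_one_add_eq (a μ : ℕ → ℂ) (N : ℕ)
    (ha : ∀ k, 1 ≤ k → 2 * a k = (if k ≤ N then μ k else 0)
      - ∑ i ∈ Finset.Icc 1 (k - 2), a i * a (k - 1 - i)) :
    (1 + PowerSeries.X ^ 2 * PowerSeries.mk fun n => a (n + 1)) ^ 2 =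
      (1 + ∑ i ∈ Finset.Icc 1 N, PowerSeries.C (μ i) * PowerSeries.X ^ (i + 1) : ℂ⟦X⟧) := by
  have hs : (∑ i ∈ Finset.Icc 1 N, PowerSeries.C (μ i) * PowerSeries.X ^ (i + 1) : ℂ⟦X⟧) =
      PowerSeries.X ^ 2 * PowerSeries.mk fun n => if n + 1 ≤ N then μ (n + 1) else 0 := by
    rw [PowerSeries.ext_iff]
    intro n
    rw [map_sum, PowerSeries.coeff_X_pow_mul', PowerSeries.coeff_mk]
    simp only [PowerSeries.coeff_C_mul, PowerSeries.coeff_X_pow, mul_ite, mul_one, mul_zero]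
    split_ifs with h2 hN
    · rw [Finset.sum_eq_single_of_mem (n - 2 + 1) (by simp; omega), if_pos (by omega)]
      intro i _ hi
      rw [if_neg (by omega)]
    · refine Finset.sum_eq_zero fun i hi => if_neg ?_
      have := Finset.mem_Icc.mp hi
      omega
    · refine Finset.sum_eq_zero fun i hi => if_neg ?_
      have := Finset.mem_Icc.mp hi
      omega
  have hsq : ∀ n, PowerSeries.coeff n (PowerSeries.X ^ 2 *
      ((PowerSeries.mk fun n => a (n + 1)) * PowerSeries.mk fun n => a (n + 1)) : ℂ⟦X⟧) =
      ∑ i ∈ Finset.Icc 1 (n + 1 - 2), a i * a (n + 1 - 1 - i) := by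
    intro n
    rw [PowerSeries.coeff_X_pow_mul']
    split_ifs with h2
    · rw [PowerSeries.coeff_mul, Finset.Nat.sum_antidiagonal_eq_sum_range_succ_mk]
      refine Finset.sum_nbij' (· + 1) (· - 1) ?_ ?_ ?_ ?_ ?_
      · intro i hi
        simp only [Finset.mem_range, Finset.mem_Icc] at hi ⊢
        omega
      · intro i hi
        simp only [Finset.mem_range, Finset.mem_Icc] at hi ⊢
        omega
      · intro i _
        simp
      · intro i hi
        simp only [Finset.mem_Icc] at hi
        omega
      · intro i hi
        simp only [Finset.mem_range] at hi
        rw [PowerSeries.coeff_mk, PowerSeries.coeff_mk,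
          show n + 1 - 1 - (i + 1) = n - 2 - i + 1 by omega]
    · rw [Finset.Icc_eq_empty (by omega), Finset.sum_empty]
  have key : (2 : ℂ⟦X⟧) * (PowerSeries.mk fun n => a (n + 1)) +
      PowerSeries.X ^ 2 * ((PowerSeries.mk fun n => a (n + 1)) * PowerSeries.mk fun n => a (n +
        1)) =
      PowerSeries.mk fun n => if n + 1 ≤ N then μ (n + 1) else 0 := by
    rw [PowerSeries.ext_iff]
    intro n
    rw [map_add, ← map_ofNat (PowerSeries.C (R := ℂ)) 2, PowerSeries.coeff_C_mul,
      PowerSeries.coeff_mk, PowerSeries.coeff_mk, ha (n + 1) (by omega), hsq, sub_add_cancel]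
  rw [hs, ← key]
  ring

end

section

open scoped PowerSeries

variable {g : ℕ} {Ω : Set (Fin g → ℂ)}

/-- The sequence `-2, v 1, …, v g, 0, 0, …` in the algebra of holomorphic functions on `Ω`. -/
def holoSeq (v : ℕ → (Fin g → ℂ) → ℂ) (hv : ∀ m, 1 ≤ m → m ≤ g → AnalyticOnNhd ℂ (v m) Ω)
    (m : ℕ) : Holo Ω :=
  if h : 1 ≤ m ∧ m ≤ g then resHolo (v m) (hv m h.1 h.2) else if m = 0 then -2 else 0

theorem holoDeriv_iterate_resHolo (hΩ : IsOpen Ω) (m n : ℕ) (f : (Fin g → ℂ) → ℂ)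
    (hf : AnalyticOnNhd ℂ f Ω) :
    (holoDeriv hΩ m)^[n] (resHolo f hf) = resHolo ((pd g m)^[n] f) (hf.pd_iterate m n) := by
  induction n with
  | zero => rfl
  | succ n ih =>
    rw [Function.iterate_succ_apply', ih, holoDeriv_resHolo]
    exact resHolo_congr.mpr (by rw [Function.iterate_succ_apply']; exact fun _ _ => rfl)

section
variable (v : ℕ → (Fin g → ℂ) → ℂ) (hv : ∀ m, 1 ≤ m → m ≤ g → AnalyticOnNhd ℂ (v m) Ω)

theorem holoSeq_zero : holoSeq v hv 0 = -2 := by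
  simp [holoSeq]

theorem holoSeq_of_le {m : ℕ} (h : 1 ≤ m) (h' : m ≤ g) :
    holoSeq v hv m = resHolo (v m) (hv m h h') := by
  rw [holoSeq, dif_pos ⟨h, h'⟩]

theorem holoSeq_of_lt {m : ℕ} (h : g < m) : holoSeq v hv m = 0 := by
  rw [holoSeq, dif_neg (by omega), if_neg (by omega)]

theorem analyticOnNhd_Lfun (hv : ∀ m, 1 ≤ m → m ≤ g → AnalyticOnNhd ℂ (v m) Ω)
    (hg : 1 ≤ g) {f : (Fin g → ℂ) → ℂ} (hf : AnalyticOnNhd ℂ f Ω) :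
    AnalyticOnNhd ℂ (Lfun g v f) Ω :=
  ((hf.pd 1).pd 1).sub ((hv 1 le_rfl hg).mul hf)

theorem analyticOnNhd_Bfun (hv : ∀ m, 1 ≤ m → m ≤ g → AnalyticOnNhd ℂ (v m) Ω)
    (hg : 1 ≤ g) {k : ℕ} (hk : 1 ≤ k) (hk' : k ≤ g)
    {f : (Fin g → ℂ) → ℂ} (hf : AnalyticOnNhd ℂ f Ω) : AnalyticOnNhd ℂ (Bfun g v k f) Ω := by
  have h1 := hv 1 le_rfl hg
  have h2 := hv k hk hk'
  exact (((((hf.pd 1).pd 1).pd k).sub (((h1.mul (hf.pd k)).add ((h1.mul hf).pd k)).const_smul)).sub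
    (((h2.mul (hf.pd 1)).add ((h2.mul hf).pd 1)).const_smul)).sub (hf.pd (k + 1))

theorem schr_resHolo (hΩ : IsOpen Ω) (hg : 1 ≤ g) {f : (Fin g → ℂ) → ℂ}
    (hf : AnalyticOnNhd ℂ f Ω) :
    schr (holoDeriv hΩ) (holoSeq v hv) (resHolo f hf) =
      resHolo (Lfun g v f) (analyticOnNhd_Lfun v hv hg hf) := by
  simp only [schr, holoDeriv_resHolo, holoSeq_of_le v hv le_rfl hg]
  rfl

theorem bsOp_resHolo (hΩ : IsOpen Ω) (hg : 1 ≤ g) {k : ℕ} (hk : 1 ≤ k) (hk' : k ≤ g)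
    {f : (Fin g → ℂ) → ℂ} (hf : AnalyticOnNhd ℂ f Ω) :
    bsOp (holoDeriv hΩ) (holoSeq v hv) k (resHolo f hf) =
      resHolo (Bfun g v k f) (analyticOnNhd_Bfun v hv hg hk hk' hf) := by
  have hmul : ∀ (a b : (Fin g → ℂ) → ℂ) (ha : AnalyticOnNhd ℂ a Ω) (hb : AnalyticOnNhd ℂ b Ω),
      resHolo a ha * resHolo b hb = resHolo (a * b) (ha.mul hb) := fun _ _ _ _ => rfl
  simp only [bsOp, holoSeq_of_le v hv le_rfl hg, holoSeq_of_le v hv hk hk', hmul, holoDeriv_resHolo]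
  rfl

theorem relations_holoSeq (hΩ : IsOpen Ω) (hg : 1 ≤ g) (hcomm : OpsCommute g Ω v) :
    (∀ k, 1 ≤ k → holoDeriv hΩ k (holoSeq v hv 1) = holoDeriv hΩ 1 (holoSeq v hv k)) ∧
    ∀ l, 1 ≤ l → coeffDeriv (holoDeriv hΩ l)
      (genQuad (holoDeriv hΩ 1) (holoSeq v hv 1) (PowerSeries.mk (holoSeq v hv))) = 0 := by
  obtain ⟨x, hx⟩ := exists_holoDeriv_one_eq_one hΩ hg
  have hs : ∀ k, 1 ≤ k → k ≤ g → ∀ f, schr (holoDeriv hΩ) (holoSeq v hv)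
      (bsOp (holoDeriv hΩ) (holoSeq v hv) k f) =
      bsOp (holoDeriv hΩ) (holoSeq v hv) k (schr (holoDeriv hΩ) (holoSeq v hv) f) := by
    intro k hk hk' f
    obtain ⟨F, hF, rfl⟩ := exists_resHolo f
    rw [bsOp_resHolo v hv hΩ hg hk hk', schr_resHolo v hv hΩ hg, schr_resHolo v hv hΩ hg,
      bsOp_resHolo v hv hΩ hg hk hk']
    exact resHolo_congr.mpr (hcomm F hF k k hk hk' hk hk').1
  have hb : ∀ k l, 1 ≤ k → k ≤ g → 1 ≤ l → l ≤ g → ∀ f,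
      bsOp (holoDeriv hΩ) (holoSeq v hv) k (bsOp (holoDeriv hΩ) (holoSeq v hv) l f) =
      bsOp (holoDeriv hΩ) (holoSeq v hv) l (bsOp (holoDeriv hΩ) (holoSeq v hv) k f) := by
    intro k l hk hk' hl hl' f
    obtain ⟨F, hF, rfl⟩ := exists_resHolo f
    rw [bsOp_resHolo v hv hΩ hg hl hl', bsOp_resHolo v hv hΩ hg hk hk',
      bsOp_resHolo v hv hΩ hg hk hk', bsOp_resHolo v hv hΩ hg hl hl']
    exact resHolo_congr.mpr (hcomm F hF k l hk hk' hl hl').2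
  obtain ⟨h1, hlin, hrel⟩ := relations_of_commute (holoDeriv hΩ) (holoDeriv_comm hΩ)
    (holoSeq v hv) g (holoSeq_zero v hv) (fun _ => holoSeq_of_lt v hv)
    (fun _ => holoDeriv_of_lt hΩ) x hx hs hb
  exact ⟨h1, coeffDeriv_genQuad_eq_zero (holoDeriv hΩ) (holoDeriv_comm hΩ) (holoSeq v hv) g
    (holoSeq_zero v hv) (fun _ => holoDeriv_of_lt hΩ) h1 hlin hrel⟩

theorem Polynomial.coe_ofNat_powerSeries (n : ℕ) [n.AtLeastTwo] :
    ((ofNat(n) : Polynomial ℂ) : ℂ⟦X⟧) = ofNat(n) :=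
  map_ofNat Polynomial.coeToPowerSeries.ringHom n

theorem coeff_cpoly (t : Fin g → ℂ) (i n : ℕ) : (cpoly g v i t).coeff n =
    if 1 ≤ n ∧ n ≤ g then (1 : ℂ) / 2 * ((pd g 1)^[i - 1] (v n)) t else 0 := by
  rw [cpoly, Polynomial.finsetSum_coeff]
  simp only [Polynomial.coeff_C_mul, Polynomial.coeff_X_pow, mul_ite, mul_one, mul_zero]
  simp only [Finset.sum_ite_eq, Finset.mem_Icc]

theorem map_evalHolo_mk (t : Ω) :
    PowerSeries.map (evalHolo t) (PowerSeries.mk (holoSeq v hv)) =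
      -2 * (1 - (cpoly g v 1 t : Polynomial ℂ) : ℂ⟦X⟧) := by
  have h2 : (-2 : ℂ⟦X⟧) = PowerSeries.C (-2) := by rw [map_neg, map_ofNat]
  ext n
  rw [h2, PowerSeries.coeff_map, PowerSeries.coeff_mk, PowerSeries.coeff_C_mul, map_sub,
    Polynomial.coeff_coe, coeff_cpoly, PowerSeries.coeff_one]
  by_cases h : 1 ≤ n ∧ n ≤ g
  · rw [if_pos h, if_neg (by omega), holoSeq_of_le v hv h.1 h.2, evalHolo_resHolo]
    simp
  · rw [if_neg h, holoSeq, dif_neg h]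
    split_ifs <;> simp [map_ofNat]

theorem map_evalHolo_coeffDeriv_iterate (hΩ : IsOpen Ω) (t : Ω) (i : ℕ) :
    PowerSeries.map (evalHolo t)
        ((coeffDeriv (holoDeriv hΩ 1))^[i + 1] (PowerSeries.mk (holoSeq v hv))) =
      2 * ((cpoly g v (i + 2) t : Polynomial ℂ) : ℂ⟦X⟧) := by
  have h2 : (2 : ℂ⟦X⟧) = PowerSeries.C 2 := by rw [map_ofNat]
  have hc : ∀ i, (coeffDeriv (holoDeriv hΩ 1))^[i] (PowerSeries.mk (holoSeq v hv)) =
      PowerSeries.mk fun n => (holoDeriv hΩ 1)^[i] (holoSeq v hv n) := by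
    intro i
    induction i with
    | zero => rfl
    | succ i ih => simp only [Function.iterate_succ_apply', ih, coeffDeriv_mk]
  ext n
  rw [h2, hc, PowerSeries.coeff_map, PowerSeries.coeff_mk, PowerSeries.coeff_C_mul,
    Polynomial.coeff_coe, coeff_cpoly]
  by_cases h : 1 ≤ n ∧ n ≤ g
  · rw [if_pos h, holoSeq_of_le v hv h.1 h.2, holoDeriv_iterate_resHolo, evalHolo_resHolo]
    simp
  · have h0 : holoDeriv hΩ 1 (holoSeq v hv n) = 0 := by
      rw [holoSeq, dif_neg h]
      split_ifs <;> simp [Derivation.map_ofNat]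
    rw [if_neg h, Function.iterate_succ_apply, h0, mul_zero,
      Function.iterate_fixed (map_zero _), map_zero]

theorem genIdent_iff (hΩ : IsOpen Ω) (hg : 1 ≤ g) (μ : ℕ → ℂ) :
    GenIdent g Ω v μ ↔
      genQuad (holoDeriv hΩ 1) (holoSeq v hv 1) (PowerSeries.mk (holoSeq v hv)) =
        PowerSeries.map (algebraMap ℂ (Holo Ω)) (16 * (1 + ∑ i ∈ Finset.Icc 1 (2 * g),
          PowerSeries.C (μ i) * PowerSeries.X ^ (i + 1))) := by
  have hT' : ∀ t : Ω, PowerSeries.map (evalHolo t)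
      (coeffDeriv (holoDeriv hΩ 1) (PowerSeries.mk (holoSeq v hv))) =
      2 * ((cpoly g v 2 t : Polynomial ℂ) : ℂ⟦X⟧) := fun t =>
    map_evalHolo_coeffDeriv_iterate v hv hΩ t 0
  have hT'' : ∀ t : Ω, PowerSeries.map (evalHolo t)
      (coeffDeriv (holoDeriv hΩ 1) (coeffDeriv (holoDeriv hΩ 1) (PowerSeries.mk (holoSeq v hv)))) =
      2 * ((cpoly g v 3 t : Polynomial ℂ) : ℂ⟦X⟧) := fun t =>
    map_evalHolo_coeffDeriv_iterate v hv hΩ t 1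
  have hE : ∀ t : Ω, PowerSeries.map (evalHolo t)
      (genQuad (holoDeriv hΩ 1) (holoSeq v hv 1) (PowerSeries.mk (holoSeq v hv))) =
      4 * ((Polynomial.X * (cpoly g v 2 t) ^ 2
      + 2 * Polynomial.X * cpoly g v 3 t * (1 - cpoly g v 1 t)
      + 4 * (1 + Polynomial.C (v 1 t) * Polynomial.X) * (1 - cpoly g v 1 t) ^ 2 :
        Polynomial ℂ) : ℂ⟦X⟧) := by
    intro t
    simp only [genQuad, map_add, map_sub, map_mul, map_pow, map_ofNat, map_one, hT', hT'',
      map_evalHolo_mk, PowerSeries.map_X, PowerSeries.map_C, holoSeq_of_le v hv le_rfl hg,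
      evalHolo_resHolo, Polynomial.coe_add, Polynomial.coe_sub, Polynomial.coe_mul,
      Polynomial.coe_pow, Polynomial.coe_X, Polynomial.coe_C, Polynomial.coe_one,
      Polynomial.coe_ofNat_powerSeries]
    ring
  have hM : ∀ t : Ω, PowerSeries.map (evalHolo t) (PowerSeries.map (algebraMap ℂ (Holo Ω))
      (16 * (1 + ∑ i ∈ Finset.Icc 1 (2 * g), PowerSeries.C (μ i) * PowerSeries.X ^ (i + 1)))) =
      4 * ((4 + 4 * ∑ i ∈ Finset.Icc 1 (2 * g), Polynomial.C (μ i) * Polynomial.X ^ (i + 1) :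
        Polynomial ℂ) : ℂ⟦X⟧) := by
    intro t
    have hs : ((∑ i ∈ Finset.Icc 1 (2 * g), Polynomial.C (μ i) * Polynomial.X ^ (i + 1) :
        Polynomial ℂ) : ℂ⟦X⟧) =
        ∑ i ∈ Finset.Icc 1 (2 * g), PowerSeries.C (μ i) * PowerSeries.X ^ (i + 1) := by
      rw [← Polynomial.coeToPowerSeries.ringHom_apply, map_sum]
      simp
    have hid : ∀ f : ℂ⟦X⟧, PowerSeries.map (evalHolo t)
        (PowerSeries.map (algebraMap ℂ (Holo Ω)) f) = f := by
      intro f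
      ext n
      simp [evalHolo_algebraMap]
    rw [hid, Polynomial.coe_add, Polynomial.coe_mul, hs]
    simp only [Polynomial.coe_ofNat_powerSeries]
    ring
  constructor
  · intro h
    ext n : 1
    refine holo_ext fun t => ?_
    rw [← PowerSeries.coeff_map, ← PowerSeries.coeff_map, hE, hM, h t t.2]
  · intro h t ht
    have h4 := hE ⟨t, ht⟩
    rw [h, hM] at h4
    exact (Polynomial.coe_injective ℂ (ofNat_mul_cancel h4)).symm

theorem exists_genIdent (hv : ∀ m, 1 ≤ m → m ≤ g → AnalyticOnNhd ℂ (v m) Ω)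
    (hΩ : IsOpen Ω) (hconn : IsConnected Ω) (hg : 1 ≤ g)
    (hcomm : OpsCommute g Ω v) : ∃ μ : ℕ → ℂ, GenIdent g Ω v μ := by
  have hE := (relations_holoSeq v hv hΩ hg hcomm).2
  have hc : ∀ n, ∃ c : ℂ, PowerSeries.coeff n (genQuad (holoDeriv hΩ 1) (holoSeq v hv 1)
      (PowerSeries.mk (holoSeq v hv))) = algebraMap ℂ (Holo Ω) c := fun n =>
    eq_algebraMap_of_holoDeriv_eq_zero hΩ hconn _ fun l hl _ => by
      rw [← coeff_coeffDeriv, hE l hl, map_zero]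
  choose c hc using hc
  refine ⟨fun i => c (i + 1) / 16, (genIdent_iff v hv hΩ hg _).mpr ?_⟩
  ext n : 1
  rw [PowerSeries.coeff_map]
  have h16 : ∀ f : ℂ⟦X⟧, PowerSeries.coeff n (16 * f) = 16 * PowerSeries.coeff n f := fun f => by
    rw [← map_ofNat (PowerSeries.C (R := ℂ)) 16, PowerSeries.coeff_C_mul]
  rw [h16, map_add, map_sum]
  simp only [PowerSeries.coeff_C_mul, PowerSeries.coeff_X_pow, PowerSeries.coeff_one, mul_ite,
    mul_one, mul_zero]
  by_cases hn : n ∈ Finset.Icc 2 (2 * g + 1)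
  · obtain ⟨h2, hn⟩ := Finset.mem_Icc.mp hn
    rw [Finset.sum_eq_single_of_mem (n - 1) (by simp; omega), if_neg (by omega),
      if_pos (by omega), show n - 1 + 1 = n by omega, zero_add,
      mul_div_cancel₀ _ (by norm_num), hc]
    intro i _ hi
    rw [if_neg (by omega)]
  · rw [Finset.sum_eq_zero fun i hi => if_neg fun h => hn ?_]
    · rw [Finset.mem_Icc] at hn
      have : n = 0 ∨ n = 1 ∨ 2 * g + 1 < n := by omega
      rcases this with rfl | rfl | h
      · rw [coeff_zero_genQuad _ _ (holoSeq_zero v hv)]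
        simp only [if_true, add_zero, mul_one, map_ofNat]
      · rw [coeff_one_genQuad _ _ (holoSeq_zero v hv)]
        simp
      · rw [coeff_genQuad_eq_zero _ _ (holoSeq_zero v hv) _ (fun _ => holoSeq_of_lt v hv) h,
          if_neg (by omega)]
        simp
    · rw [Finset.mem_Icc] at hi ⊢
      omega

theorem kdv_of_genIdent (hΩ : IsOpen Ω) (hg : 1 ≤ g) (hcomm : OpsCommute g Ω v) (μ : ℕ → ℂ)
    (hμ : GenIdent g Ω v μ) (a : ℕ → ℂ)
    (ha : ∀ k, 1 ≤ k → 2 * a k = (if k ≤ 2 * g then μ k else 0)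
      - ∑ i ∈ Finset.Icc 1 (k - 2), a i * a (k - 1 - i)) (k : ℕ) (hk : 1 ≤ k) :
    holoDeriv hΩ (k + 1) (holoSeq v hv 1) =
      holoDeriv hΩ 1 (gdSeq (holoDeriv hΩ 1) (holoSeq v hv 1) (k + 1)) +
        ∑ j ∈ Finset.range (k - 1),
          a (k - j - 1) • holoDeriv hΩ 1 (gdSeq (holoDeriv hΩ 1) (holoSeq v hv 1) (j + 1)) := by
  rw [(relations_holoSeq v hv hΩ hg hcomm).1 (k + 1) (by omega)]
  rw [genIdent_iff v hv hΩ hg, ← sq_one_add_eq a μ (2 * g) ha] at hμ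
  have h := eq_mul_gdSeq _ _ _ (holoSeq_zero v hv) _ (by simp) hμ
  obtain ⟨m, rfl⟩ := Nat.exists_eq_add_one_of_ne_zero (by omega : k ≠ 0)
  have hm := congrArg (fun f => holoDeriv hΩ 1 (PowerSeries.coeff (m + 2) f)) h
  simp only [map_add, map_mul, map_pow, map_one, PowerSeries.map_X, add_mul, one_mul, mul_assoc,
    PowerSeries.coeff_X_pow_mul, PowerSeries.coeff_mk] at hm
  rw [PowerSeries.coeff_mul] at hm
  rw [hm, Finset.Nat.sum_antidiagonal_eq_sum_range_succ_mk, ← Finset.sum_range_reflect,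
    Finset.sum_range_succ', map_add, map_sum]
  congr 1
  have h0 : ∀ (c : ℂ) (f : Holo Ω), holoDeriv hΩ 1 (algebraMap ℂ (Holo Ω) c * f) =
      c • holoDeriv hΩ 1 f := fun c f => by rw [← Algebra.smul_def, Derivation.map_smul]
  simp only [PowerSeries.coeff_map, PowerSeries.coeff_mk, h0]
  rw [show m - (m.succ - 1 - 0) = 0 by omega, gdSeq_zero, map_neg, Derivation.map_ofNat, neg_zero,
    smul_zero, add_zero]
  refine Finset.sum_congr rfl fun j hj => ?_
  have := Finset.mem_range.mp hj
  rw [show m - (m.succ - 1 - (j + 1)) = j + 1 by omega,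
    show m.succ - 1 - (j + 1) + 1 = m + 1 - j - 1 by omega]

theorem eval_iterate_pd (hΩ : IsOpen Ω) (hg : 1 ≤ g) (t : Ω) (n : ℕ) :
    MvPolynomial.eval (fun i => ((pd g 1)^[i] (v 1)) t) (Hder (gdSeq Hder (X 0) n)) =
      evalHolo t (holoDeriv hΩ 1 (gdSeq (holoDeriv hΩ 1) (holoSeq v hv 1) n)) := by
  let φ : HH →ₐ[ℂ] Holo Ω := aeval fun i => (holoDeriv hΩ 1)^[i] (holoSeq v hv 1)
  have hφ : ∀ p, φ (Hder p) = holoDeriv hΩ 1 (φ p) := by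
    intro p
    induction p using MvPolynomial.induction_on with
    | C a =>
      rw [← algebraMap_eq, AlgHom.commutes, Derivation.map_algebraMap, Derivation.map_algebraMap,
        map_zero]
    | add p q hp hq => rw [map_add, map_add, hp, hq, map_add, map_add]
    | mul_X p i hp =>
      simp only [Derivation.leibniz, Hder_X, smul_eq_mul, map_add, map_mul, hp, φ, aeval_X,
        Function.iterate_succ_apply']
  have he : ∀ p, MvPolynomial.eval (fun i => ((pd g 1)^[i] (v 1)) t) p = evalHolo t (φ p) := by
    intro p
    induction p using MvPolynomial.induction_on with
    | C a => rw [eval_C, ← algebraMap_eq, AlgHom.commutes, evalHolo_algebraMap]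
    | add p q hp hq => rw [map_add, map_add, hp, hq, map_add]
    | mul_X p i hp =>
      rw [map_mul, map_mul, hp, map_mul, eval_X, aeval_X, holoSeq_of_le v hv le_rfl hg,
        holoDeriv_iterate_resHolo, evalHolo_resHolo]
  rw [he, hφ, ← AlgHom.coe_toRingHom, map_gdSeq Hder (holoDeriv hΩ 1) (φ : HH →+* Holo Ω) hφ]
  simp [φ]

end

end

/-- if the operators L, B₃, …, B_{2g+1} commute, then there exist
constants μ₄, …, μ_{4g+2} satisfying the generating identity on Ω, and for any such μ,
defining a₄, a₆, … recursively by 2a_{2k+2} = μ_{2k+2} − Σ_{i=1}^{k−2} a_{2i+2}a_{2k−2i}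
(with μ_{2k+2} = 0 for k > 2g), the function u = v₂ solves the parametric KdV hierarchy
∂_{2k+1}u = r_{2k+3}[u] + Σ_{j=0}^{k−2} a_{2k−2j} r_{2j+3}[u] on Ω for every k ≥ 1
(with ∂_{2k+1}u = 0 for 2k+1 > 2g−1).  Here `v m` denotes v_{2m}, `μ i` denotes
μ_{2i+2}, `a i` denotes a_{2i+2} and `r k` denotes r_{2k+3}. -/
theorem stmt17 (g : ℕ) (hg : 1 ≤ g) (Ω : Set (Fin g → ℂ)) (hΩ : IsOpen Ω)
    (hconn : IsConnected Ω)
    (v : ℕ → (Fin g → ℂ) → ℂ) (hv : ∀ m, 1 ≤ m → m ≤ g → AnalyticOnNhd ℂ (v m) Ω)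
    (hcomm : OpsCommute g Ω v)
    (r : ℕ → HH) (hr0 : r 0 = MvPolynomial.X 1)
    (hr : ∀ k, 1 ≤ k → ∃ α : Fin k → HH,
      (∀ j : Fin k, (α j).IsWeightedHomogeneous wtH (2 * ((j : ℕ) + 1))) ∧
      ⁅LopH, AopH k α⁆ = mulH (r k)) :
    (∃ μ : ℕ → ℂ, GenIdent g Ω v μ) ∧
    (∀ μ : ℕ → ℂ, GenIdent g Ω v μ →
      ∀ a : ℕ → ℂ,
        (∀ k, 1 ≤ k →
          2 * a k = (if k ≤ 2 * g then μ k else 0)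
            - ∑ i ∈ Finset.Icc 1 (k - 2), a i * a (k - 1 - i)) →
        ∀ k, 1 ≤ k → ∀ t ∈ Ω,
          pd g (k + 1) (v 1) t
            = MvPolynomial.eval (fun i => ((pd g 1)^[i] (v 1)) t) (r k)
              + ∑ j ∈ Finset.range (k - 1),
                  a (k - j - 1) * MvPolynomial.eval (fun i => ((pd g 1)^[i] (v 1)) t) (r j)) := by
  refine ⟨exists_genIdent v hv hΩ hconn hg hcomm, fun μ hμ a ha k hk t ht => ?_⟩
  have h := congrArg (evalHolo ⟨t, ht⟩) (kdv_of_genIdent v hv hΩ hg hcomm μ hμ a ha k hk)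
  have hl : evalHolo ⟨t, ht⟩ (holoDeriv hΩ (k + 1) (holoSeq v hv 1)) = pd g (k + 1) (v 1) t := by
    rw [holoSeq_of_le v hv le_rfl hg, holoDeriv_resHolo, evalHolo_resHolo]
  rw [hl, map_add, map_sum, ← eval_iterate_pd v hv hΩ hg ⟨t, ht⟩] at h
  rw [h, eq_Hder_gdSeq r hr0 hr]
  refine congrArg _ (Finset.sum_congr rfl fun j _ => ?_)
  rw [Algebra.smul_def, map_mul, evalHolo_algebraMap, ← eval_iterate_pd v hv hΩ hg ⟨t, ht⟩,
    eq_Hder_gdSeq r hr0 hr]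

end
end
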